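/- arXiv:1011.2974 — 14 statements merged into one kernel-verified Lean document; each statement's English description precedes it below -/
import Mathlib

section
/- Let M0, M1, M2, M3 be real numbers with M0 > 0 and M0*M2 - M1^2 > 0. Then there exist real numbers ρ1 > 0, ρ2 > 0 and v1 > v2 such that M_i = ρ1*v1^i + ρ2*v2^i for i = 0, 1, 2, 3. Moreover any such ρ1, ρ2 satisfy 0 < ρ1 < M0 and 0 < ρ2 < M0. -/
theorem exists_pos_mul_eq_sub_eq {s : ℝ} (hs : 0 < s) (q : ℝ) :
    ∃ a b : ℝ, 0 < a ∧ 0 < b ∧ a * b = s ∧ a - b = q := by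
  have hsq : √(q ^ 2 + 4 * s) ^ 2 = q ^ 2 + 4 * s := Real.sq_sqrt (by positivity)
  have hlt : |q| < √(q ^ 2 + 4 * s) := by
    rw [← Real.sqrt_sq_eq_abs]
    exact Real.sqrt_lt_sqrt (sq_nonneg q) (by linarith)
  obtain ⟨hneg, hpos⟩ := abs_lt.mp hlt
  refine ⟨(√(q ^ 2 + 4 * s) + q) / 2, (√(q ^ 2 + 4 * s) - q) / 2, ?_, ?_, ?_, ?_⟩
  · linarith
  · linarith
  · linear_combination hsq / 4
  · ring

/-- A vector in the moment space is determined by its mass `M0`, its mean `m` and two distances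
`a`, `b` from the mean, which are those of the two nodes of its quadrature. -/
theorem exists_mean_and_distances {M0 M1 M2 : ℝ} (M3 : ℝ) (hM0 : 0 < M0)
    (hmom : 0 < M0 * M2 - M1 ^ 2) :
    ∃ m a b : ℝ, 0 < a ∧ 0 < b ∧ M1 = M0 * m ∧ M2 = M0 * (m ^ 2 + a * b) ∧
      M3 = M0 * (m ^ 3 + 3 * m * (a * b) + a * b * (a - b)) := by
  have hs : 0 < (M0 * M2 - M1 ^ 2) / M0 ^ 2 := by positivity
  obtain ⟨a, b, ha, hb, hab, hsub⟩ := exists_pos_mul_eq_sub_eq hs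
    ((M3 / M0 - (M1 / M0) ^ 3 - 3 * (M1 / M0) * ((M0 * M2 - M1 ^ 2) / M0 ^ 2)) /
      ((M0 * M2 - M1 ^ 2) / M0 ^ 2))
  refine ⟨M1 / M0, a, b, ha, hb, ?_, ?_, ?_⟩
  · field_simp
  · rw [hab]
    field_simp
    ring
  · rw [hsub, hab, mul_div_cancel₀ _ hs.ne']
    field_simp
    ring

theorem stmt_0 (M0 M1 M2 M3 : ℝ) (hM0 : 0 < M0) (hmom : 0 < M0 * M2 - M1 ^ 2) :
    (∃ ρ1 ρ2 v1 v2 : ℝ, 0 < ρ1 ∧ 0 < ρ2 ∧ v2 < v1 ∧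
      M0 = ρ1 + ρ2 ∧ M1 = ρ1 * v1 + ρ2 * v2 ∧
      M2 = ρ1 * v1 ^ 2 + ρ2 * v2 ^ 2 ∧ M3 = ρ1 * v1 ^ 3 + ρ2 * v2 ^ 3) ∧
    (∀ ρ1 ρ2 v1 v2 : ℝ, 0 < ρ1 → 0 < ρ2 → v2 < v1 →
      M0 = ρ1 + ρ2 → M1 = ρ1 * v1 + ρ2 * v2 →
      M2 = ρ1 * v1 ^ 2 + ρ2 * v2 ^ 2 → M3 = ρ1 * v1 ^ 3 + ρ2 * v2 ^ 3 →
      0 < ρ1 ∧ ρ1 < M0 ∧ 0 < ρ2 ∧ ρ2 < M0) := by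
  refine ⟨?_, fun ρ1 ρ2 v1 v2 hρ1 hρ2 _ hsum _ _ _ => ⟨hρ1, by linarith, hρ2, by linarith⟩⟩
  obtain ⟨m, a, b, ha, hb, hM1, hM2, hM3⟩ := exists_mean_and_distances M3 hM0 hmom
  refine ⟨M0 * b / (a + b), M0 * a / (a + b), m + a, m - b, by positivity, by positivity,
    by linarith, ?_, ?_, ?_, ?_⟩
  · field_simp
    ring
  · rw [hM1]
    field_simp
    ring
  · rw [hM2]
    field_simp
    ring
  · rw [hM3]
    field_simp
    ring
end

section
/- Let M0, M1, M2, M3 be real numbers with M0 > 0 and M0*M2 - M1^2 > 0. If (ρ1, ρ2, v1, v2) and (ρ1', ρ2', v1', v2') both satisfy ρ1, ρ2, ρ1', ρ2' > 0, v1 > v2, v1' > v2', and M_i = ρ1*v1^i + ρ2*v2^i = ρ1'*(v1')^i + ρ2'*(v2')^i for i = 0, 1, 2, 3, then ρ1 = ρ1', ρ2 = ρ2', v1 = v1', v2 = v2'. -/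
/-- The sum and product of the abscissas of a two-node quadrature are determined by its moments:
they solve a linear system whose determinant is the Hankel determinant `M0 * M2 - M1 ^ 2`. -/
theorem add_eq_and_mul_eq_of_moment_recurrence {M0 M1 M2 M3 s p s' p' : ℝ} (hM0 : M0 ≠ 0)
    (hmom : M0 * M2 - M1 ^ 2 ≠ 0)
    (h2 : M2 = s * M1 - p * M0) (h3 : M3 = s * M2 - p * M1)
    (h2' : M2 = s' * M1 - p' * M0) (h3' : M3 = s' * M2 - p' * M1) :
    s = s' ∧ p = p' := by
  have hs : s = s' := by
    apply sub_eq_zero.mp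
    apply (mul_eq_zero.mp _).resolve_right hmom
    linear_combination M0 * (h3' - h3) - M1 * (h2' - h2)
  subst hs
  refine ⟨rfl, mul_right_cancel₀ hM0 ?_⟩
  linear_combination h2 - h2'

/-- An ordered pair of reals is determined by its sum and product. -/
theorem eq_and_eq_of_add_eq_of_mul_eq {a b a' b' : ℝ} (h : b < a) (h' : b' < a')
    (hs : a + b = a' + b') (hp : a * b = a' * b') : a = a' ∧ b = b' := by
  have hroot : (a - a') * (a - b') = 0 := by linear_combination a * hs - hp
  rcases mul_eq_zero.mp hroot with h0 | h0
  · exact ⟨by linarith, by linarith⟩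
  · linarith

theorem stmt_1 (M0 M1 M2 M3 : ℝ) (hM0 : 0 < M0) (hmom : 0 < M0 * M2 - M1 ^ 2)
    (ρ1 ρ2 v1 v2 ρ1' ρ2' v1' v2' : ℝ)
    (hρ1 : 0 < ρ1) (hρ2 : 0 < ρ2) (hρ1' : 0 < ρ1') (hρ2' : 0 < ρ2')
    (hv : v2 < v1) (hv' : v2' < v1')
    (h0 : M0 = ρ1 + ρ2) (h1 : M1 = ρ1 * v1 + ρ2 * v2)
    (h2 : M2 = ρ1 * v1 ^ 2 + ρ2 * v2 ^ 2) (h3 : M3 = ρ1 * v1 ^ 3 + ρ2 * v2 ^ 3)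
    (h0' : M0 = ρ1' + ρ2') (h1' : M1 = ρ1' * v1' + ρ2' * v2')
    (h2' : M2 = ρ1' * v1' ^ 2 + ρ2' * v2' ^ 2) (h3' : M3 = ρ1' * v1' ^ 3 + ρ2' * v2' ^ 3) :
    ρ1 = ρ1' ∧ ρ2 = ρ2' ∧ v1 = v1' ∧ v2 = v2' := by
  obtain ⟨hs, hp⟩ : v1 + v2 = v1' + v2' ∧ v1 * v2 = v1' * v2' :=
    add_eq_and_mul_eq_of_moment_recurrence (M3 := M3) hM0.ne' hmom.ne'
      (by rw [h0, h1, h2]; ring) (by rw [h1, h2, h3]; ring)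
      (by rw [h0', h1', h2']; ring) (by rw [h1', h2', h3']; ring)
  obtain ⟨rfl, rfl⟩ := eq_and_eq_of_add_eq_of_mul_eq hv hv' hs hp
  have hρ : ρ1 = ρ1' := by
    apply mul_right_cancel₀ (sub_pos.mpr hv).ne'
    linear_combination h1' - h1 - v2 * (h0' - h0)
  exact ⟨hρ, by linarith, rfl, rfl⟩
end

section
/- Let v1, v2 be real numbers and set σ0 = v1*v2, σ1 = -(v1 + v2). Let J be the 4×4 real matrix whose first three rows are (0,1,0,0), (0,0,1,0), (0,0,0,1) and whose last row is (-σ0^2, -2*σ0*σ1, -2*σ0 - σ1^2, -2*σ1). Then the characteristic polynomial of J is (X - v1)^2 * (X - v2)^2. -/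
open Polynomial

theorem stmt_4 (v1 v2 σ0 σ1 : ℝ) (hσ0 : σ0 = v1 * v2) (hσ1 : σ1 = -(v1 + v2))
    (J : Matrix (Fin 4) (Fin 4) ℝ)
    (hJ : J = !![0, 1, 0, 0;
                 0, 0, 1, 0;
                 0, 0, 0, 1;
                 -σ0 ^ 2, -2 * σ0 * σ1, -2 * σ0 - σ1 ^ 2, -2 * σ1]) :
    J.charpoly = (X - C v1) ^ 2 * (X - C v2) ^ 2 := by
  subst hσ0 hσ1 hJ
  simp only [Matrix.charpoly, Matrix.charmatrix, Matrix.det_succ_row_zero, Fin.sum_univ_succ]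
  simp [Fin.succAbove, Matrix.scalar_apply, Matrix.diagonal, Fin.lt_def, Fin.ext_iff]
  rw [map_ofNat C 2]
  ring
end

section
/- Let ρ1, ρ2 > 0 and v1 > v2 be real numbers, set M_i = ρ1*v1^i + ρ2*v2^i for i = 0, 1, 2, 3, and define e = M0*M2 - M1^2 and q = (M3*M0^2 - M1^3) - 3*M1*(M0*M2 - M1^2). Then (v1 - v2)^2 = q^2/(M0^2*e^2) + 4*e/M0^2 and q = e*(ρ1 - ρ2)*(v2 - v1). -/
theorem stmt_5 (ρ1 ρ2 v1 v2 M0 M1 M2 M3 e q : ℝ)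
    (hρ1 : 0 < ρ1) (hρ2 : 0 < ρ2) (hv : v2 < v1)
    (h0 : M0 = ρ1 + ρ2) (h1 : M1 = ρ1 * v1 + ρ2 * v2)
    (h2 : M2 = ρ1 * v1 ^ 2 + ρ2 * v2 ^ 2) (h3 : M3 = ρ1 * v1 ^ 3 + ρ2 * v2 ^ 3)
    (he : e = M0 * M2 - M1 ^ 2)
    (hq : q = (M3 * M0 ^ 2 - M1 ^ 3) - 3 * M1 * (M0 * M2 - M1 ^ 2)) :
    (v1 - v2) ^ 2 = q ^ 2 / (M0 ^ 2 * e ^ 2) + 4 * e / M0 ^ 2 ∧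
    q = e * (ρ1 - ρ2) * (v2 - v1) := by
  have he' : e = ρ1 * ρ2 * (v1 - v2) ^ 2 := by
    subst h0 h1 h2 he
    ring
  have hq' : q = e * (ρ1 - ρ2) * (v2 - v1) := by
    rw [he', hq, h0, h1, h2, h3]
    ring
  refine ⟨?_, hq'⟩
  have hd : 0 < v1 - v2 := sub_pos.mpr hv
  have he0 : e ≠ 0 := by
    rw [he']
    positivity
  have hM0 : M0 ≠ 0 := by
    rw [h0]
    positivity
  have hq_sq : q ^ 2 / (M0 ^ 2 * e ^ 2) = ((ρ1 - ρ2) * (v2 - v1)) ^ 2 / M0 ^ 2 := by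
    rw [hq']
    field_simp
  rw [hq_sq, ← add_div, eq_div_iff (pow_ne_zero 2 hM0), he', h0]
  ring
end

section
/- Fix real numbers M0 > 0, M1, and q > 0. For e > 0 define Δ(e) = sqrt(q^2 + 4*e^3), v1(e) = M1/M0 + (q + Δ(e))/(2*M0*e), v2(e) = M1/M0 + (q - Δ(e))/(2*M0*e), ρ2(e) = M0*(q + Δ(e))/(2*Δ(e)), ρ1(e) = M0 - ρ2(e). Then, as e → 0 from the right: ρ2(e) → M0, ρ1(e) → 0, v2(e) → M1/M0, v1(e) → +∞, ρ2(e)*v2(e) → M1, and ρ1(e)*v1(e) → 0. -/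
open Filter Topology

theorem stmt_6 (M0 M1 q : ℝ) (hM0 : 0 < M0) (hq : 0 < q)
    (Δ v1 v2 ρ1 ρ2 : ℝ → ℝ)
    (hΔ : ∀ e, Δ e = Real.sqrt (q ^ 2 + 4 * e ^ 3))
    (hv1 : ∀ e, v1 e = M1 / M0 + (q + Δ e) / (2 * M0 * e))
    (hv2 : ∀ e, v2 e = M1 / M0 + (q - Δ e) / (2 * M0 * e))
    (hρ2 : ∀ e, ρ2 e = M0 * (q + Δ e) / (2 * Δ e))
    (hρ1 : ∀ e, ρ1 e = M0 - ρ2 e) :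
    Tendsto ρ2 (𝓝[>] 0) (𝓝 M0) ∧
    Tendsto ρ1 (𝓝[>] 0) (𝓝 0) ∧
    Tendsto v2 (𝓝[>] 0) (𝓝 (M1 / M0)) ∧
    Tendsto v1 (𝓝[>] 0) atTop ∧
    Tendsto (fun e => ρ2 e * v2 e) (𝓝[>] 0) (𝓝 M1) ∧
    Tendsto (fun e => ρ1 e * v1 e) (𝓝[>] 0) (𝓝 0) := by
  have hΔ_tendsto : Tendsto Δ (𝓝[>] 0) (𝓝 q) := by
    have hcont : Continuous Δ := by
      rw [funext hΔ]
      fun_prop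
    have hzero : Δ 0 = q := by
      rw [hΔ]
      simp [Real.sqrt_sq hq.le]
    simpa only [hzero] using (hcont.tendsto 0).mono_left nhdsWithin_le_nhds
  have he_tendsto : Tendsto (fun e : ℝ => e) (𝓝[>] 0) (𝓝 0) :=
    tendsto_id.mono_left nhdsWithin_le_nhds
  have hΔ_pos : ∀ e : ℝ, 0 < e → 0 < Δ e := fun e he => by
    rw [hΔ]
    positivity
  have hΔ_sq : ∀ e : ℝ, 0 < e → Δ e ^ 2 = q ^ 2 + 4 * e ^ 3 := fun e he => by
    rw [hΔ, Real.sq_sqrt (by positivity)]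
  have hρ2_tendsto : Tendsto ρ2 (𝓝[>] 0) (𝓝 M0) := by
    have h := ((hΔ_tendsto.const_add q).const_mul M0).div (hΔ_tendsto.const_mul 2)
      (by positivity)
    rw [show M0 * (q + q) / (2 * q) = M0 by field_simp; ring] at h
    exact h.congr fun e => (hρ2 e).symm
  have hv2_tendsto : Tendsto v2 (𝓝[>] 0) (𝓝 (M1 / M0)) := by
    have h := (((he_tendsto.pow 2).const_mul (2 : ℝ)).div
      ((hΔ_tendsto.const_add q).const_mul M0) (by positivity)).const_sub (M1 / M0)
    rw [show M1 / M0 - 2 * (0 : ℝ) ^ 2 / (M0 * (q + q)) = M1 / M0 by simp] at h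
    refine h.congr' ?_
    filter_upwards [self_mem_nhdsWithin] with e (he : 0 < e)
    have hpos := hΔ_pos e he
    have hkey : (q - Δ e) / (2 * M0 * e) = -(2 * e ^ 2 / (M0 * (q + Δ e))) := by
      rw [← neg_div, div_eq_div_iff (by positivity) (by positivity)]
      linear_combination -M0 * hΔ_sq e he
    rw [hv2, hkey, Pi.div_apply, sub_eq_add_neg]
  have hρ2v2_tendsto : Tendsto (fun e => ρ2 e * v2 e) (𝓝[>] 0) (𝓝 M1) := by
    simpa only [mul_div_cancel₀ M1 hM0.ne'] using hρ2_tendsto.mul hv2_tendsto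
  refine ⟨hρ2_tendsto, ?_, hv2_tendsto, ?_, hρ2v2_tendsto, ?_⟩
  · rw [funext hρ1]
    simpa using hρ2_tendsto.const_sub M0
  · have h := tendsto_atTop_add_const_left _ (M1 / M0)
      (((hΔ_tendsto.const_add q).div_const (2 * M0)).pos_mul_atTop (by positivity)
        tendsto_inv_nhdsGT_zero)
    refine h.congr fun e => ?_
    rw [hv1, ← div_eq_mul_inv, div_div]
  · have h := hρ2v2_tendsto.const_sub M1
    rw [sub_self] at h
    refine h.congr' ?_
    filter_upwards [self_mem_nhdsWithin] with e (he : 0 < e)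
    have hpos := hΔ_pos e he
    rw [hρ1, hρ2, hv1, hv2]
    field_simp
    ring
end

section
/- Fix real numbers M0 > 0, M1, and q < 0. For e > 0 define Δ(e) = sqrt(q^2 + 4*e^3), v1(e) = M1/M0 + (q + Δ(e))/(2*M0*e), v2(e) = M1/M0 + (q - Δ(e))/(2*M0*e), ρ2(e) = M0*(q + Δ(e))/(2*Δ(e)), ρ1(e) = M0 - ρ2(e). Then, as e → 0 from the right: ρ2(e) → 0, ρ1(e) → M0, v2(e) → -∞, v1(e) → M1/M0, ρ2(e)*v2(e) → 0, and ρ1(e)*v1(e) → M1. -/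
open Filter Topology

theorem stmt_7 (M0 M1 q : ℝ) (hM0 : 0 < M0) (hq : q < 0)
    (Δ v1 v2 ρ1 ρ2 : ℝ → ℝ)
    (hΔ : ∀ e, Δ e = Real.sqrt (q ^ 2 + 4 * e ^ 3))
    (hv1 : ∀ e, v1 e = M1 / M0 + (q + Δ e) / (2 * M0 * e))
    (hv2 : ∀ e, v2 e = M1 / M0 + (q - Δ e) / (2 * M0 * e))
    (hρ2 : ∀ e, ρ2 e = M0 * (q + Δ e) / (2 * Δ e))
    (hρ1 : ∀ e, ρ1 e = M0 - ρ2 e) :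
    Tendsto ρ2 (𝓝[>] 0) (𝓝 0) ∧
    Tendsto ρ1 (𝓝[>] 0) (𝓝 M0) ∧
    Tendsto v2 (𝓝[>] 0) atBot ∧
    Tendsto v1 (𝓝[>] 0) (𝓝 (M1 / M0)) ∧
    Tendsto (fun e => ρ2 e * v2 e) (𝓝[>] 0) (𝓝 0) ∧
    Tendsto (fun e => ρ1 e * v1 e) (𝓝[>] 0) (𝓝 M1) := by
  have hΔ0 : Tendsto Δ (𝓝[>] 0) (𝓝 (-q)) := by
    have hc : Continuous Δ := by
      rw [funext hΔ]
      fun_prop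
    have h0 : Δ 0 = -q := by
      rw [hΔ]
      simp [Real.sqrt_sq_eq_abs, abs_of_neg hq]
    exact h0 ▸ (hc.tendsto 0).mono_left nhdsWithin_le_nhds
  have he : Tendsto (fun e : ℝ => e) (𝓝[>] 0) (𝓝 0) := nhdsWithin_le_nhds
  have hpos : ∀ e : ℝ, 0 < e → 0 < Δ e := fun e h => by
    rw [hΔ]
    positivity
  have hsq : ∀ e : ℝ, 0 < e → Δ e ^ 2 = q ^ 2 + 4 * e ^ 3 := fun e h => by
    rw [hΔ, Real.sq_sqrt (by positivity)]
  have hq' : -q ≠ 0 := by linarith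
  have tρ2 : Tendsto ρ2 (𝓝[>] 0) (𝓝 0) := by
    rw [funext hρ2]
    have h : Tendsto (fun e => M0 * (q + Δ e) / (2 * Δ e)) (𝓝[>] 0)
        (𝓝 (M0 * (q + -q) / (2 * -q))) :=
      ((hΔ0.const_add q).const_mul M0).div (hΔ0.const_mul 2) (mul_ne_zero two_ne_zero hq')
    simpa using h
  have tρ1 : Tendsto ρ1 (𝓝[>] 0) (𝓝 M0) := by
    rw [funext hρ1]
    simpa using tρ2.const_sub M0
  have tv1 : Tendsto v1 (𝓝[>] 0) (𝓝 (M1 / M0)) := by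
    have h : Tendsto (fun e => M1 / M0 + 2 * e ^ 2 / (M0 * (Δ e - q))) (𝓝[>] 0)
        (𝓝 (M1 / M0 + 2 * 0 ^ 2 / (M0 * (-q - q)))) :=
      (((he.pow 2).const_mul 2).div ((hΔ0.sub_const q).const_mul M0)
        (mul_ne_zero hM0.ne' (by linarith))).const_add _
    rw [show M1 / M0 + 2 * 0 ^ 2 / (M0 * (-q - q)) = M1 / M0 by simp] at h
    refine h.congr' ?_
    filter_upwards [self_mem_nhdsWithin] with e (h0 : 0 < e)
    have hne : Δ e - q ≠ 0 := by linarith [hpos e h0]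
    rw [hv1]
    congr 1
    rw [div_eq_div_iff (mul_ne_zero hM0.ne' hne) (by positivity)]
    linear_combination (-M0) * hsq e h0
  have tv2 : Tendsto v2 (𝓝[>] 0) atBot := by
    have h1 : Tendsto (fun e => (q - Δ e) / (2 * M0)) (𝓝[>] 0) (𝓝 ((q - -q) / (2 * M0))) :=
      (hΔ0.const_sub q).div_const _
    have h := tendsto_atBot_add_const_left _ (M1 / M0)
      (h1.neg_mul_atTop (div_neg_of_neg_of_pos (by linarith) (by positivity))
        tendsto_inv_nhdsGT_zero)
    refine h.congr fun e => ?_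
    rw [hv2, ← div_eq_mul_inv, div_div]
  refine ⟨tρ2, tρ1, tv2, tv1, ?_, ?_⟩
  · have h : Tendsto (fun e => ρ2 e * (M1 / M0) - e ^ 2 / Δ e) (𝓝[>] 0)
        (𝓝 (0 * (M1 / M0) - 0 ^ 2 / -q)) :=
      (tρ2.mul_const _).sub ((he.pow 2).div hΔ0 hq')
    rw [show 0 * (M1 / M0) - 0 ^ 2 / -q = 0 by simp] at h
    refine h.congr' ?_
    filter_upwards [self_mem_nhdsWithin] with e (h0 : 0 < e)
    have hne := (hpos e h0).ne'
    have key : ρ2 e * ((q - Δ e) / (2 * M0 * e)) = -(e ^ 2 / Δ e) := by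
      rw [hρ2, div_mul_div_comm, ← neg_div, div_eq_div_iff (by positivity) hne]
      linear_combination (-(M0 * Δ e)) * hsq e h0
    rw [hv2, mul_add, key, sub_eq_add_neg]
  · have h := tρ1.mul tv1
    rwa [mul_div_cancel₀ _ hM0.ne'] at h
end

section
/- Let ν > 0 and let M0, M1, e, q : [0, 1] → ℝ be continuous with M0(x) ≥ ν for all x, e(0) = 0, e(x) > 0 for x > 0. For x > 0 let ρ1(x), ρ2(x), v1(x) > v2(x) be the two-node quadrature weights and abscissas given by Δ = sqrt(q^2 + 4*e^3), v1 = M1/M0 + (q + Δ)/(2*M0*e), v2 = M1/M0 + (q - Δ)/(2*M0*e), ρ2 = M0*(q + Δ)/(2*Δ), ρ1 = M0 - ρ2. Suppose q(x)/(M0(x)*e(x)) converges to some real l as x → 0⁺. Then v1(x) - v2(x) → |l| as x → 0⁺, and if l ≠ 0 then |ρ1(x) - ρ2(x)| → M0(0) (so one weight tends to 0 and the other to M0(0)). -/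
open Filter Topology

theorem sqrt_discriminant_div {m e q : ℝ} (hm : 0 < m) (he : 0 < e) :
    √(q ^ 2 + 4 * e ^ 3) / (m * e) = √((q / (m * e)) ^ 2 + 4 * e / m ^ 2) := by
  have hme : 0 < m * e := mul_pos hm he
  have h : (q / (m * e)) ^ 2 + 4 * e / m ^ 2 = (q ^ 2 + 4 * e ^ 3) / (m * e) ^ 2 := by
    field_simp
  rw [h, Real.sqrt_div (by positivity), Real.sqrt_sq hme.le]

theorem abscissas_sub {m a e q : ℝ} (hm : 0 < m) (he : 0 < e) (d : ℝ) :
    (a / m + (q + d) / (2 * m * e)) - (a / m + (q - d) / (2 * m * e)) = d / (m * e) := by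
  field_simp
  ring

theorem abs_weights_sub {m e q d : ℝ} (hm : 0 < m) (he : 0 < e) (hd : 0 < d) :
    |m - m * (q + d) / (2 * d) - m * (q + d) / (2 * d)| =
      m * (|q / (m * e)| / (d / (m * e))) := by
  have h : m - m * (q + d) / (2 * d) - m * (q + d) / (2 * d) = -(m * (q / d)) := by
    field_simp
    ring
  rw [h, abs_neg, abs_mul, abs_of_pos hm, abs_div, abs_div, abs_of_pos hd,
    abs_of_pos (mul_pos hm he)]
  field_simp

theorem stmt_10 (ν l : ℝ) (hν : 0 < ν)
    (M0 M1 e q ρ1 ρ2 v1 v2 : ℝ → ℝ)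
    (hM0c : ContinuousOn M0 (Set.Icc 0 1)) (hM1c : ContinuousOn M1 (Set.Icc 0 1))
    (hec : ContinuousOn e (Set.Icc 0 1)) (hqc : ContinuousOn q (Set.Icc 0 1))
    (hM0 : ∀ x ∈ Set.Icc (0:ℝ) 1, ν ≤ M0 x)
    (he0 : e 0 = 0)
    (hepos : ∀ x ∈ Set.Ioc (0:ℝ) 1, 0 < e x)
    (hv1 : ∀ x ∈ Set.Ioc (0:ℝ) 1,
      v1 x = M1 x / M0 x + (q x + Real.sqrt (q x ^ 2 + 4 * e x ^ 3)) / (2 * M0 x * e x))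
    (hv2 : ∀ x ∈ Set.Ioc (0:ℝ) 1,
      v2 x = M1 x / M0 x + (q x - Real.sqrt (q x ^ 2 + 4 * e x ^ 3)) / (2 * M0 x * e x))
    (hρ2 : ∀ x ∈ Set.Ioc (0:ℝ) 1,
      ρ2 x = M0 x * (q x + Real.sqrt (q x ^ 2 + 4 * e x ^ 3)) /
        (2 * Real.sqrt (q x ^ 2 + 4 * e x ^ 3)))
    (hρ1 : ∀ x ∈ Set.Ioc (0:ℝ) 1, ρ1 x = M0 x - ρ2 x)
    (hl : Tendsto (fun x => q x / (M0 x * e x)) (𝓝[Set.Ioc 0 1] 0) (𝓝 l)) :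
    Tendsto (fun x => v1 x - v2 x) (𝓝[Set.Ioc 0 1] 0) (𝓝 |l|) ∧
    (l ≠ 0 → Tendsto (fun x => |ρ1 x - ρ2 x|) (𝓝[Set.Ioc 0 1] 0) (𝓝 (M0 0))) := by
  have h0 : (0 : ℝ) ∈ Set.Icc (0 : ℝ) 1 := by simp
  have hmem : ∀ᶠ x in 𝓝[Set.Ioc 0 1] (0 : ℝ), x ∈ Set.Ioc (0 : ℝ) 1 := self_mem_nhdsWithin
  have hpos : ∀ x ∈ Set.Ioc (0 : ℝ) 1, 0 < M0 x :=
    fun x hx => hν.trans_le (hM0 x (Set.Ioc_subset_Icc_self hx))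
  have hM0_ne : M0 0 ≠ 0 := (hν.trans_le (hM0 0 h0)).ne'
  have hM0_lim : Tendsto M0 (𝓝[Set.Ioc 0 1] 0) (𝓝 (M0 0)) :=
    (hM0c 0 h0).mono Set.Ioc_subset_Icc_self
  have he_lim : Tendsto e (𝓝[Set.Ioc 0 1] 0) (𝓝 0) := by
    simpa only [ContinuousWithinAt, he0] using (hec 0 h0).mono Set.Ioc_subset_Icc_self
  have hΔ_lim : Tendsto (fun x => √(q x ^ 2 + 4 * e x ^ 3) / (M0 x * e x))
      (𝓝[Set.Ioc 0 1] 0) (𝓝 |l|) := by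
    have h := ((hl.pow 2).add
      ((he_lim.const_mul 4).div (hM0_lim.pow 2) (pow_ne_zero 2 hM0_ne))).sqrt
    rw [mul_zero, zero_div, add_zero, Real.sqrt_sq_eq_abs] at h
    refine h.congr' ?_
    filter_upwards [hmem] with x hx
    exact (sqrt_discriminant_div (hpos x hx) (hepos x hx)).symm
  refine ⟨hΔ_lim.congr' ?_, fun hl0 => ?_⟩
  · filter_upwards [hmem] with x hx
    rw [hv1 x hx, hv2 x hx, abscissas_sub (hpos x hx) (hepos x hx)]
  · have h := hM0_lim.mul (hl.abs.div hΔ_lim (abs_ne_zero.2 hl0))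
    rw [div_self (abs_ne_zero.2 hl0), mul_one] at h
    refine h.congr' ?_
    filter_upwards [hmem] with x hx
    have he := hepos x hx
    rw [hρ1 x hx, hρ2 x hx]
    exact (abs_weights_sub (hpos x hx) he (by positivity)).symm
end

section
/- Let ρ1, ρ2 > 0 and v1 ≠ v2 be real numbers, set M_i = ρ1*v1^i + ρ2*v2^i for i = 0, 1, 2, 3, and let e = M0*M2 - M1^2 and q = (M3*M0^2 - M1^3) - 3*M1*(M0*M2 - M1^2). Then e > 0 and the closed fourth moment M4bar = ρ1*v1^4 + ρ2*v2^4 satisfies M4bar/M0 = -( (q/(M0*e))*(M1/M0) + (M1/M0)^2 - e/M0^2 ) * ( e/M0^2 + (M1/M0)^2 ) + ( q/(M0*e) + 2*(M1/M0) ) * ( q/M0^3 + (M1/M0)^3 + 3*(M1/M0)*(e/M0^2) ). -/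
theorem stmt_11 (ρ1 ρ2 v1 v2 M0 M1 M2 M3 e q M4bar : ℝ)
    (hρ1 : 0 < ρ1) (hρ2 : 0 < ρ2) (hv : v1 ≠ v2)
    (h0 : M0 = ρ1 + ρ2) (h1 : M1 = ρ1 * v1 + ρ2 * v2)
    (h2 : M2 = ρ1 * v1 ^ 2 + ρ2 * v2 ^ 2) (h3 : M3 = ρ1 * v1 ^ 3 + ρ2 * v2 ^ 3)
    (he : e = M0 * M2 - M1 ^ 2)
    (hq : q = (M3 * M0 ^ 2 - M1 ^ 3) - 3 * M1 * (M0 * M2 - M1 ^ 2))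
    (hM4 : M4bar = ρ1 * v1 ^ 4 + ρ2 * v2 ^ 4) :
    0 < e ∧
    M4bar / M0 =
      -((q / (M0 * e)) * (M1 / M0) + (M1 / M0) ^ 2 - e / M0 ^ 2) *
          (e / M0 ^ 2 + (M1 / M0) ^ 2) +
        (q / (M0 * e) + 2 * (M1 / M0)) *
          (q / M0 ^ 3 + (M1 / M0) ^ 3 + 3 * (M1 / M0) * (e / M0 ^ 2)) := by
  subst h0 h1 h2 h3
  have he' : e = ρ1 * ρ2 * (v1 - v2) ^ 2 := by rw [he]; ring
  have hq' : q = (ρ2 - ρ1) * (v1 - v2) * e := by rw [hq, he]; ring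
  have he_pos : 0 < e := by
    have := sub_ne_zero.mpr hv
    rw [he']
    positivity
  have hM0 : ρ1 + ρ2 ≠ 0 := (add_pos hρ1 hρ2).ne'
  have hsum : q / ((ρ1 + ρ2) * e) + 2 * ((ρ1 * v1 + ρ2 * v2) / (ρ1 + ρ2)) = v1 + v2 := by
    rw [hq']
    field_simp
    ring
  have hprod : q / ((ρ1 + ρ2) * e) * ((ρ1 * v1 + ρ2 * v2) / (ρ1 + ρ2)) +
      ((ρ1 * v1 + ρ2 * v2) / (ρ1 + ρ2)) ^ 2 - e / (ρ1 + ρ2) ^ 2 = v1 * v2 := by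
    rw [eq_sub_of_add_eq hsum, he']
    field_simp
    ring
  refine ⟨he_pos, ?_⟩
  rw [hsum, hprod, hM4, hq', he']
  field_simp
  ring
end

section
/- Let m0 > 0, m1 ∈ ℝ and η > 0. Let M0, M1, e, q : (0, 1] → ℝ be functions with M0(x) → m0, M1(x) → m1, e(x) → 0 as x → 0⁺, e(x) > 0 and |q(x)/(M0(x)*e(x))| ≤ η for all x. Define G(x) = M0(x) * [ -( (q/(M0*e))*(M1/M0) + (M1/M0)^2 - e/M0^2 )*( e/M0^2 + (M1/M0)^2 ) + ( q/(M0*e) + 2*M1/M0 )*( q/M0^3 + (M1/M0)^3 + 3*(M1/M0)*(e/M0^2) ) ] (all quantities evaluated at x). Then G(x) → m1^4/m0^3 as x → 0⁺; i.e., the quadrature-closed flux component M4bar tends to M1^4/M0^3 at the frontier of the moment space along any path inside the cone |q/(M0*e)| ≤ η. -/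
open Filter Topology

theorem stmt_12 (m0 m1 η : ℝ) (hm0 : 0 < m0) (hη : 0 < η)
    (M0 M1 e q G : ℝ → ℝ)
    (hM0lim : Tendsto M0 (𝓝[Set.Ioc 0 1] 0) (𝓝 m0))
    (hM1lim : Tendsto M1 (𝓝[Set.Ioc 0 1] 0) (𝓝 m1))
    (helim : Tendsto e (𝓝[Set.Ioc 0 1] 0) (𝓝 0))
    (hepos : ∀ x ∈ Set.Ioc (0:ℝ) 1, 0 < e x)
    (hcone : ∀ x ∈ Set.Ioc (0:ℝ) 1, |q x / (M0 x * e x)| ≤ η)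
    (hG : ∀ x ∈ Set.Ioc (0:ℝ) 1,
      G x = M0 x *
        (-((q x / (M0 x * e x)) * (M1 x / M0 x) + (M1 x / M0 x) ^ 2 - e x / M0 x ^ 2) *
            (e x / M0 x ^ 2 + (M1 x / M0 x) ^ 2) +
          (q x / (M0 x * e x) + 2 * (M1 x / M0 x)) *
            (q x / M0 x ^ 3 + (M1 x / M0 x) ^ 3 + 3 * (M1 x / M0 x) * (e x / M0 x ^ 2)))) :
    Tendsto G (𝓝[Set.Ioc 0 1] 0) (𝓝 (m1 ^ 4 / m0 ^ 3)) := by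
  have hu : Tendsto (fun x => M1 x / M0 x) (𝓝[Set.Ioc 0 1] 0) (𝓝 (m1 / m0)) :=
    hM1lim.div hM0lim hm0.ne'
  have hε : Tendsto (fun x => e x / M0 x ^ 2) (𝓝[Set.Ioc 0 1] 0) (𝓝 0) := by
    simpa [Pi.div_def] using helim.div (hM0lim.pow 2) (pow_ne_zero 2 hm0.ne')
  have hbdd : IsBoundedUnder (· ≤ ·) (𝓝[Set.Ioc (0 : ℝ) 1] 0)
      (norm ∘ fun x => q x / (M0 x * e x)) :=
    isBoundedUnder_of_eventually_le (a := η) (eventually_mem_nhdsWithin.mono hcone)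
  have hrε : Tendsto (fun x => q x / (M0 x * e x) * (e x / M0 x ^ 2))
      (𝓝[Set.Ioc 0 1] 0) (𝓝 0) := isBoundedUnder_le_mul_tendsto_zero hbdd hε
  have hrrε : Tendsto (fun x => q x / (M0 x * e x) *
      (q x / (M0 x * e x) * (e x / M0 x ^ 2))) (𝓝[Set.Ioc 0 1] 0) (𝓝 0) :=
    isBoundedUnder_le_mul_tendsto_zero hbdd hrε
  have hlim := hM0lim.mul ((((hu.pow 4).add (hε.pow 2)).add
    (((hu.pow 2).const_mul 6).mul hε)).add (((hu.const_mul 4).mul hrε).add hrrε))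
  have hval : m0 * ((m1 / m0) ^ 4 + 0 ^ 2 + 6 * (m1 / m0) ^ 2 * 0 +
      (4 * (m1 / m0) * 0 + 0)) = m1 ^ 4 / m0 ^ 3 := by
    field_simp
    ring
  rw [hval] at hlim
  refine hlim.congr' ?_
  filter_upwards [eventually_mem_nhdsWithin, hM0lim.eventually_ne hm0.ne'] with x hx hM
  have he := (hepos x hx).ne'
  have hq : q x / M0 x ^ 3 = q x / (M0 x * e x) * (e x / M0 x ^ 2) := by
    field_simp
  rw [hG x hx, hq]
  ring
end

section
/- Let S : ℝ → ℝ be four times continuously differentiable with S''''(v) ≥ 0 for all v ∈ ℝ. Then for all real v1, v2: (i) 6*(S(v1) - S(v2)) - 4*(v1 - v2)*S'(v1) - 2*(v1 - v2)*S'(v2) + (v1 - v2)^2*S''(v1) ≥ 0, and (ii) -6*(S(v1) - S(v2)) + 2*(v1 - v2)*S'(v1) + 4*(v1 - v2)*S'(v2) + (v1 - v2)^2*S''(v2) ≥ 0. -/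
/-- A function vanishing at `a` whose derivative has the sign of `x - a` is nonnegative. -/
theorem nonneg_of_hasDerivAt_of_sub_mul_nonneg {F F' : ℝ → ℝ} {a : ℝ}
    (hF : ∀ x, HasDerivAt F (F' x) x) (ha : F a = 0) (h : ∀ x, 0 ≤ (x - a) * F' x) (x : ℝ) :
    0 ≤ F x := by
  have hc : Continuous F := continuous_iff_continuousAt.2 fun y => (hF y).continuousAt
  rcases lt_trichotomy x a with hx | rfl | hx
  · obtain ⟨c, hc, e⟩ := exists_hasDerivAt_eq_slope F F' hx hc.continuousOn fun y _ => hF y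
    have hF' : F' c ≤ 0 := nonpos_of_mul_nonneg_right (h c) (sub_neg.2 hc.2)
    rw [eq_div_iff (sub_pos.2 hx).ne', ha] at e
    nlinarith
  · exact ha.ge
  · obtain ⟨c, hc, e⟩ := exists_hasDerivAt_eq_slope F F' hx hc.continuousOn fun y _ => hF y
    have hF' : 0 ≤ F' c := nonneg_of_mul_nonneg_right (h c) (sub_pos.2 hc.1)
    rw [eq_div_iff (sub_pos.2 hx).ne', ha] at e
    nlinarith

/-- The first of the two inequalities, in terms of explicit successive derivatives. -/
theorem hermite_remainder_nonneg {S S₁ S₂ S₃ S₄ : ℝ → ℝ}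
    (h₁ : ∀ x, HasDerivAt S (S₁ x) x) (h₂ : ∀ x, HasDerivAt S₁ (S₂ x) x)
    (h₃ : ∀ x, HasDerivAt S₂ (S₃ x) x) (h₄ : ∀ x, HasDerivAt S₃ (S₄ x) x)
    (hS₄ : ∀ x, 0 ≤ S₄ x) (a b : ℝ) :
    0 ≤ 6 * (S a - S b) - 4 * (a - b) * S₁ a - 2 * (a - b) * S₁ b + (a - b) ^ 2 * S₂ a := by
  have hid (x : ℝ) : HasDerivAt (fun y => y - a) 1 x := (hasDerivAt_id x).sub_const a
  have hH : ∀ x, 0 ≤ (x - a) * S₃ x - (S₂ x - S₂ a) := by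
    refine nonneg_of_hasDerivAt_of_sub_mul_nonneg (a := a) (F' := fun x => (x - a) * S₄ x)
      (fun x => ?_) (by ring) fun x => ?_
    · refine (((hid x).mul (h₄ x)).sub ((h₃ x).sub_const (S₂ a))).congr_deriv ?_
      ring
    · rw [← mul_assoc]
      exact mul_nonneg (mul_self_nonneg _) (hS₄ x)
  have hG : Monotone fun x => (x - a) * (S₂ x + S₂ a) - 2 * (S₁ x - S₁ a) := by
    refine monotone_of_hasDerivAt_nonneg
      (f' := fun x => (x - a) * S₃ x - (S₂ x - S₂ a)) (fun x => ?_) hH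
    refine (((hid x).mul ((h₃ x).add_const (S₂ a))).sub
      (((h₂ x).sub_const (S₁ a)).const_mul 2)).congr_deriv ?_
    ring
  refine nonneg_of_hasDerivAt_of_sub_mul_nonneg (a := a)
    (F := fun b => 6 * (S a - S b) - 4 * (a - b) * S₁ a - 2 * (a - b) * S₁ b + (a - b) ^ 2 * S₂ a)
    (F' := fun x => 2 * ((x - a) * (S₂ x + S₂ a) - 2 * (S₁ x - S₁ a)))
    (fun x => ?_) (by ring) (fun x => ?_) b
  · have hd : HasDerivAt (fun y => a - y) (-1) x := (hasDerivAt_id x).const_sub a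
    refine ((((((h₁ x).const_sub (S a)).const_mul 6).sub ((hd.const_mul 4).mul_const (S₁ a))).sub
      ((hd.const_mul 2).mul (h₂ x))).add ((hd.pow 2).mul_const (S₂ a))).congr_deriv ?_
    push_cast
    ring
  · rcases le_total a x with hx | hx
    · have := hG hx
      simp only [sub_self, zero_mul, mul_zero] at this
      exact mul_nonneg (sub_nonneg.2 hx) (by linarith)
    · have := hG hx
      simp only [sub_self, zero_mul, mul_zero] at this
      exact mul_nonneg_of_nonpos_of_nonpos (sub_nonpos.2 hx) (by linarith)

theorem stmt_13 (S : ℝ → ℝ) (hS : ContDiff ℝ 4 S)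
    (h4 : ∀ v : ℝ, 0 ≤ iteratedDeriv 4 S v) :
    ∀ v1 v2 : ℝ,
      0 ≤ 6 * (S v1 - S v2) - 4 * (v1 - v2) * deriv S v1 - 2 * (v1 - v2) * deriv S v2 +
          (v1 - v2) ^ 2 * iteratedDeriv 2 S v1 ∧
      0 ≤ -6 * (S v1 - S v2) + 2 * (v1 - v2) * deriv S v1 + 4 * (v1 - v2) * deriv S v2 +
          (v1 - v2) ^ 2 * iteratedDeriv 2 S v2 := by
  have hd (n : ℕ) (hn : n < 4) (x : ℝ) :
      HasDerivAt (iteratedDeriv n S) (iteratedDeriv (n + 1) S x) x := by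
    rw [iteratedDeriv_succ]
    exact (hS.differentiable_iteratedDeriv n (mod_cast hn) x).hasDerivAt
  have key := hermite_remainder_nonneg (hd 0 (by norm_num)) (hd 1 (by norm_num))
    (hd 2 (by norm_num)) (hd 3 (by norm_num)) h4
  simp only [iteratedDeriv_zero, zero_add, iteratedDeriv_one] at key
  refine fun v1 v2 => ⟨key v1 v2, (key v2 v1).trans_eq ?_⟩
  ring
end

section
/- Let v1 ≠ v2 be real numbers and set σ0 = v1*v2, σ1 = -(v1 + v2). Define the 4×4 real matrices J with rows (0,1,0,0), (0,0,1,0), (0,0,0,1), (-σ0^2, -2σ0σ1, -2σ0 - σ1^2, -2σ1); A with rows (1,1,0,0), (0,0,1,1), (-v1^2, -v2^2, 2v1, 2v2), (-2v1^3, -2v2^3, 3v1^2, 3v2^2); and K with rows (0,0,1,0), (0,0,0,1), (-v1^2, 0, 2v1, 0), (0, -v2^2, 0, 2v2). Then A is invertible and A⁻¹ * J * A = K; equivalently J * A = A * K and det A ≠ 0. -/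
theorem stmt_14 (v1 v2 σ0 σ1 : ℝ) (hv : v1 ≠ v2)
    (hσ0 : σ0 = v1 * v2) (hσ1 : σ1 = -(v1 + v2))
    (J A K : Matrix (Fin 4) (Fin 4) ℝ)
    (hJ : J = !![0, 1, 0, 0;
                 0, 0, 1, 0;
                 0, 0, 0, 1;
                 -σ0 ^ 2, -2 * σ0 * σ1, -2 * σ0 - σ1 ^ 2, -2 * σ1])
    (hA : A = !![1, 1, 0, 0;
                 0, 0, 1, 1;
                 -v1 ^ 2, -v2 ^ 2, 2 * v1, 2 * v2;
                 -2 * v1 ^ 3, -2 * v2 ^ 3, 3 * v1 ^ 2, 3 * v2 ^ 2])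
    (hK : K = !![0, 0, 1, 0;
                 0, 0, 0, 1;
                 -v1 ^ 2, 0, 2 * v1, 0;
                 0, -v2 ^ 2, 0, 2 * v2]) :
    A.det ≠ 0 ∧ J * A = A * K ∧ A⁻¹ * J * A = K := by
  have hdet : A.det = -(v1 - v2) ^ 4 := by
    rw [hA]
    simp [Matrix.det_succ_row_zero, Fin.sum_univ_succ, Fin.succAbove]
    ring
  have hne : A.det ≠ 0 := by
    rw [hdet]
    exact neg_ne_zero.mpr (pow_ne_zero _ (sub_ne_zero.mpr hv))
  have hmul : J * A = A * K := by
    subst hJ hA hK hσ0 hσ1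
    ext i j
    fin_cases i <;> fin_cases j <;> simp [Matrix.mul_apply, Fin.sum_univ_succ] <;> ring
  refine ⟨hne, hmul, ?_⟩
  rw [Matrix.mul_assoc, hmul, Matrix.nonsing_inv_mul_cancel_left _ _ hne.isUnit]
end

section
/- Let ρ1, ρ2, v1, v2 : ℝ × ℝ → ℝ be differentiable functions of (t, x) and S : ℝ → ℝ a differentiable function. Suppose that at a point (t, x), for i = 1, 2: ∂_t ρ_i + ∂_x (ρ_i v_i) = 0 and ∂_t (ρ_i v_i) + ∂_x (ρ_i v_i^2) = 0. Then at that point ∂_t ( ρ1*S(v1) + ρ2*S(v2) ) + ∂_x ( ρ1*v1*S(v1) + ρ2*v2*S(v2) ) = 0. -/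
/-- A density-weighted entropy `ρ * S v` is conserved at a point where the pressureless gas dynamics
equations hold for `(ρ, v)`. -/
theorem pressureless_entropy_conservation {ρ v : ℝ × ℝ → ℝ} {S : ℝ → ℝ} {p : ℝ × ℝ}
    (hρ : DifferentiableAt ℝ ρ p) (hv : DifferentiableAt ℝ v p) (hS : DifferentiableAt ℝ S (v p))
    (hmass : fderiv ℝ ρ p (1, 0) + fderiv ℝ (fun z => ρ z * v z) p (0, 1) = 0)
    (hmomentum : fderiv ℝ (fun z => ρ z * v z) p (1, 0) +
      fderiv ℝ (fun z => ρ z * v z ^ 2) p (0, 1) = 0) :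
    fderiv ℝ (fun z => ρ z * S (v z)) p (1, 0) +
      fderiv ℝ (fun z => ρ z * v z * S (v z)) p (0, 1) = 0 := by
  have hSv : HasFDerivAt (fun z => S (v z)) (deriv S (v p) • fderiv ℝ v p) p :=
    hS.hasDerivAt.comp_hasFDerivAt p hv.hasFDerivAt
  have hρv := hρ.hasFDerivAt.fun_mul hv.hasFDerivAt
  have hρv2 := hρ.hasFDerivAt.fun_mul (HasFDerivAt.pow hv.hasFDerivAt 2)
  rw [hρv.fderiv] at hmass hmomentum
  rw [hρv2.fderiv] at hmomentum
  rw [(hρ.hasFDerivAt.fun_mul hSv).fderiv, (hρv.fun_mul hSv).fderiv]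
  simp only [add_apply, smul_apply, smul_eq_mul, nsmul_eq_mul] at hmass hmomentum ⊢
  norm_num at hmass hmomentum ⊢
  linear_combination (S (v p) - deriv S (v p) * v p) * hmass + deriv S (v p) * hmomentum

theorem stmt_16 (ρ1 ρ2 v1 v2 : ℝ × ℝ → ℝ) (S : ℝ → ℝ)
    (hρ1 : Differentiable ℝ ρ1) (hρ2 : Differentiable ℝ ρ2)
    (hv1 : Differentiable ℝ v1) (hv2 : Differentiable ℝ v2)
    (hS : Differentiable ℝ S) (p : ℝ × ℝ)
    (hpde1 : fderiv ℝ ρ1 p (1, 0) + fderiv ℝ (fun z => ρ1 z * v1 z) p (0, 1) = 0)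
    (hpde2 : fderiv ℝ (fun z => ρ1 z * v1 z) p (1, 0) +
      fderiv ℝ (fun z => ρ1 z * v1 z ^ 2) p (0, 1) = 0)
    (hpde3 : fderiv ℝ ρ2 p (1, 0) + fderiv ℝ (fun z => ρ2 z * v2 z) p (0, 1) = 0)
    (hpde4 : fderiv ℝ (fun z => ρ2 z * v2 z) p (1, 0) +
      fderiv ℝ (fun z => ρ2 z * v2 z ^ 2) p (0, 1) = 0) :
    fderiv ℝ (fun z => ρ1 z * S (v1 z) + ρ2 z * S (v2 z)) p (1, 0) +
      fderiv ℝ (fun z => ρ1 z * v1 z * S (v1 z) + ρ2 z * v2 z * S (v2 z)) p (0, 1) = 0 := by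
  have hv1S : Differentiable ℝ (fun z => S (v1 z)) := hS.comp hv1
  have hv2S : Differentiable ℝ (fun z => S (v2 z)) := hS.comp hv2
  have h1 := pressureless_entropy_conservation (hρ1 p) (hv1 p) (hS _) hpde1 hpde2
  have h2 := pressureless_entropy_conservation (hρ2 p) (hv2 p) (hS _) hpde3 hpde4
  rw [fderiv_fun_add ((hρ1.fun_mul hv1S) p) ((hρ2.fun_mul hv2S) p),
    fderiv_fun_add (((hρ1.fun_mul hv1).fun_mul hv1S) p) (((hρ2.fun_mul hv2).fun_mul hv2S) p),
    add_apply, add_apply]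
  linear_combination h1 + h2
end

section
/- Let T > 0 and let ρ1, ρ2, v1, v2 be C^1 functions on (0, T) × ℝ satisfying pointwise, for i = 1, 2: ∂_t ρ_i + ∂_x (ρ_i v_i) = 0 and ∂_t (ρ_i v_i) + ∂_x (ρ_i v_i^2) = 0. Then for every smooth compactly supported φ : (0, T) × ℝ → ℝ and every smooth compactly supported χ : ℝ → ℝ, ∫_0^T ∫_ℝ [ ρ1(t,x)*(∂_t φ(t,x) + v1(t,x)*∂_x φ(t,x))*χ(v1(t,x)) + ρ2(t,x)*(∂_t φ(t,x) + v2(t,x)*∂_x φ(t,x))*χ(v2(t,x)) ] dx dt = 0. -/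
open MeasureTheory

theorem integral_fderiv_apply_eq_zero {h : ℝ × ℝ → ℝ} (hh : ContDiff ℝ 1 h)
    (hc : HasCompactSupport h) (w : ℝ × ℝ) :
    Integrable (fun p => fderiv ℝ h p w) ∧ ∫ p, fderiv ℝ h p w = 0 := by
  have hi : Integrable (fun p => fderiv ℝ h p w) := by
    refine Continuous.integrable_of_hasCompactSupport ?_ (hc.fderiv_apply ℝ w)
    exact (hh.continuous_fderiv one_ne_zero).clm_apply continuous_const
  refine ⟨hi, ?_⟩
  have key := integral_mul_fderiv_eq_neg_fderiv_mul_of_integrable (μ := (volume : Measure (ℝ × ℝ)))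
    (f := fun _ : ℝ × ℝ => (1 : ℝ)) (g := h) (v := w) (by simp)
    (by simpa using hi)
    (by simpa using hh.continuous.integrable_of_hasCompactSupport hc)
    (fun _ _ => differentiableAt_const _) (fun p _ => hh.differentiable one_ne_zero p)
  simpa using key

theorem contDiff_mul_of_tsupport_subset {S : Set (ℝ × ℝ)} (hS : IsOpen S) {g φ : ℝ × ℝ → ℝ}
    (hg : ContDiffOn ℝ 1 g S) (hφ : ContDiff ℝ 1 φ) (hsub : tsupport φ ⊆ S) :
    ContDiff ℝ 1 (fun p => g p * φ p) := by
  refine contDiff_iff_contDiffAt.2 fun p => ?_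
  by_cases hp : p ∈ tsupport φ
  · exact (hg.contDiffAt (hS.mem_nhds (hsub hp))).mul hφ.contDiffAt
  · have hzero : (fun p => g p * φ p) =ᶠ[nhds p] fun _ => 0 := by
      filter_upwards [notMem_tsupport_iff_eventuallyEq.1 hp] with q hq
      simp [hq]
    exact contDiffAt_const.congr_of_eventuallyEq hzero

/-- The weak free-transport identity for a single pressureless gas with density `ρ` and
velocity `v`. -/
theorem pressureless_weak_transport {S : Set (ℝ × ℝ)} (hS : IsOpen S) {ρ v φ : ℝ × ℝ → ℝ}
    {χ : ℝ → ℝ} (hρ : ContDiffOn ℝ 1 ρ S) (hv : ContDiffOn ℝ 1 v S)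
    (hmass : ∀ p ∈ S, fderiv ℝ ρ p (1, 0) + fderiv ℝ (fun z => ρ z * v z) p (0, 1) = 0)
    (hmom : ∀ p ∈ S, fderiv ℝ (fun z => ρ z * v z) p (1, 0) +
      fderiv ℝ (fun z => ρ z * v z ^ 2) p (0, 1) = 0)
    (hφ : ContDiff ℝ 1 φ) (hc : HasCompactSupport φ) (hsub : tsupport φ ⊆ S)
    (hχ : ContDiff ℝ 1 χ) :
    Integrable (fun p => ρ p * (fderiv ℝ φ p (1, 0) + v p * fderiv ℝ φ p (0, 1)) * χ (v p)) ∧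
      ∫ p, ρ p * (fderiv ℝ φ p (1, 0) + v p * fderiv ℝ φ p (0, 1)) * χ (v p) = 0 := by
  have hF := contDiff_mul_of_tsupport_subset hS (hρ.mul (hχ.comp_contDiffOn hv)) hφ hsub
  have hG := contDiff_mul_of_tsupport_subset hS
    ((hρ.mul hv).mul (hχ.comp_contDiffOn hv)) hφ hsub
  simp only [Function.comp_apply] at hF hG
  obtain ⟨hFi, hF0⟩ := integral_fderiv_apply_eq_zero hF hc.mul_left (1, 0)
  obtain ⟨hGi, hG0⟩ := integral_fderiv_apply_eq_zero hG hc.mul_left (0, 1)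
  have heq : (fun p => ρ p * (fderiv ℝ φ p (1, 0) + v p * fderiv ℝ φ p (0, 1)) * χ (v p)) =
      fun p => fderiv ℝ (fun p => ρ p * χ (v p) * φ p) p (1, 0) +
        fderiv ℝ (fun p => ρ p * v p * χ (v p) * φ p) p (0, 1) := by
    funext p
    by_cases hp : p ∈ tsupport φ
    · have hpS := hS.mem_nhds (hsub hp)
      have dρ := ((hρ.contDiffAt hpS).differentiableAt one_ne_zero).hasFDerivAt
      have dv := ((hv.contDiffAt hpS).differentiableAt one_ne_zero).hasFDerivAt
      have dφ := (hφ.differentiable one_ne_zero p).hasFDerivAt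
      have dχ := (hχ.differentiable one_ne_zero (v p)).hasDerivAt.comp_hasFDerivAt p dv
      have dρv := dρ.fun_mul dv
      have e1 := hmass p (hsub hp)
      have e2 := hmom p (hsub hp)
      rw [dρv.fderiv] at e1 e2
      rw [(dρ.fun_mul (dv.pow 2)).fderiv] at e2
      have dF := ((dρ.fun_mul dχ).fun_mul dφ).fderiv
      have dG := ((dρv.fun_mul dχ).fun_mul dφ).fderiv
      simp only [Function.comp_apply] at dF dG
      rw [dF, dG]
      simp at e1 e2 ⊢
      linear_combination (-(φ p * χ (v p)) + φ p * deriv χ (v p) * v p) * e1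
        - φ p * deriv χ (v p) * e2
    · have hz (g : ℝ × ℝ → ℝ) : fderiv ℝ (fun p => g p * φ p) p = 0 :=
        fderiv_of_notMem_tsupport ℝ fun h => hp (tsupport_mul_subset_right h)
      rw [fderiv_of_notMem_tsupport ℝ hp, hz, hz]
      simp
  rw [heq]
  exact ⟨hFi.add hGi, by rw [integral_add hFi hGi, hF0, hG0, add_zero]⟩

theorem stmt_17 (T : ℝ) (hT : 0 < T) (ρ1 ρ2 v1 v2 : ℝ × ℝ → ℝ)
    (hρ1 : ContDiffOn ℝ 1 ρ1 (Set.Ioo 0 T ×ˢ (Set.univ : Set ℝ)))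
    (hρ2 : ContDiffOn ℝ 1 ρ2 (Set.Ioo 0 T ×ˢ (Set.univ : Set ℝ)))
    (hv1 : ContDiffOn ℝ 1 v1 (Set.Ioo 0 T ×ˢ (Set.univ : Set ℝ)))
    (hv2 : ContDiffOn ℝ 1 v2 (Set.Ioo 0 T ×ˢ (Set.univ : Set ℝ)))
    (hpde1 : ∀ p ∈ Set.Ioo 0 T ×ˢ (Set.univ : Set ℝ),
      fderiv ℝ ρ1 p (1, 0) + fderiv ℝ (fun z => ρ1 z * v1 z) p (0, 1) = 0)
    (hpde2 : ∀ p ∈ Set.Ioo 0 T ×ˢ (Set.univ : Set ℝ),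
      fderiv ℝ (fun z => ρ1 z * v1 z) p (1, 0) +
        fderiv ℝ (fun z => ρ1 z * v1 z ^ 2) p (0, 1) = 0)
    (hpde3 : ∀ p ∈ Set.Ioo 0 T ×ˢ (Set.univ : Set ℝ),
      fderiv ℝ ρ2 p (1, 0) + fderiv ℝ (fun z => ρ2 z * v2 z) p (0, 1) = 0)
    (hpde4 : ∀ p ∈ Set.Ioo 0 T ×ˢ (Set.univ : Set ℝ),
      fderiv ℝ (fun z => ρ2 z * v2 z) p (1, 0) +
        fderiv ℝ (fun z => ρ2 z * v2 z ^ 2) p (0, 1) = 0) :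
    ∀ (φ : ℝ × ℝ → ℝ) (χ : ℝ → ℝ),
      ContDiff ℝ (⊤ : ℕ∞) φ → HasCompactSupport φ →
      tsupport φ ⊆ Set.Ioo 0 T ×ˢ (Set.univ : Set ℝ) →
      ContDiff ℝ (⊤ : ℕ∞) χ → HasCompactSupport χ →
      ∫ t in Set.Ioo (0:ℝ) T, ∫ x : ℝ,
        (ρ1 (t, x) * (fderiv ℝ φ (t, x) (1, 0) + v1 (t, x) * fderiv ℝ φ (t, x) (0, 1)) *
            χ (v1 (t, x)) +
          ρ2 (t, x) * (fderiv ℝ φ (t, x) (1, 0) + v2 (t, x) * fderiv ℝ φ (t, x) (0, 1)) *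
            χ (v2 (t, x))) = 0 := by
  intro φ χ hφ hc hsub hχ _
  have hS : IsOpen (Set.Ioo 0 T ×ˢ (Set.univ : Set ℝ)) := isOpen_Ioo.prod isOpen_univ
  have hφ' : ContDiff ℝ 1 φ := hφ.of_le (by exact_mod_cast le_top)
  have hχ' : ContDiff ℝ 1 χ := hχ.of_le (by exact_mod_cast le_top)
  obtain ⟨i1, z1⟩ := pressureless_weak_transport hS hρ1 hv1 hpde1 hpde2 hφ' hc hsub hχ'
  obtain ⟨i2, z2⟩ := pressureless_weak_transport hS hρ2 hv2 hpde3 hpde4 hφ' hc hsub hχ'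
  have hsum := integral_add' i1 i2
  rw [z1, z2, add_zero, Measure.volume_eq_prod, integral_prod _ (i1.add i2)] at hsum
  rw [setIntegral_eq_integral_of_forall_compl_eq_zero]
  · exact hsum
  · intro t ht
    have hz (x : ℝ) : fderiv ℝ φ (t, x) = 0 :=
      fderiv_of_notMem_tsupport ℝ fun h => ht (hsub h).1
    simp [hz]
end

section
/- Let σ_L < σ_R be real numbers, η_L, η_*, η_R, q_L, q_*, q_R real numbers, s_L, s_R real numbers, and m_L, m_R : [0, ∞) → ℝ continuous with m_L(0) = m_R(0) = 0. For smooth compactly supported φ : (0, ∞) × ℝ → ℝ define L(φ) = -∫_0^∞ [ ∫_{-∞}^{σ_L t} η_L ∂_t φ(x,t) dx + ∫_{σ_L t}^{σ_R t} η_* ∂_t φ(x,t) dx + ∫_{σ_R t}^{∞} η_R ∂_t φ(x,t) dx + m_L(t) s_L ∂_t φ(σ_L t, t) + m_R(t) s_R ∂_t φ(σ_R t, t) ] dt - ∫_0^∞ [ ∫_{-∞}^{σ_L t} q_L ∂_x φ(x,t) dx + ∫_{σ_L t}^{σ_R t} q_* ∂_x φ(x,t) dx + ∫_{σ_R t}^{∞}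 q_R ∂_x φ(x,t) dx + σ_L m_L(t) s_L ∂_x φ(σ_L t, t) + σ_R m_R(t) s_R ∂_x φ(σ_R t, t) ] dt. Then L(φ) = 0 for all such φ if and only if for all t ≥ 0: σ_L (η_L - η_*) t - (q_L - q_*) t + m_L(t) s_L = 0 and σ_R (η_* - η_R) t - (q_* - q_R) t + m_R(t) s_R = 0. -/
open MeasureTheory Set

section Slices

variable {φ : ℝ × ℝ → ℝ}

theorem HasCompactSupport.comp_graph_snd (hφ : HasCompactSupport φ) (u : ℝ → ℝ) :
    HasCompactSupport fun t => φ (u t, t) := by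
  refine HasCompactSupport.intro (hφ.isCompact.image continuous_snd) fun t ht => ?_
  by_contra h
  exact ht ⟨(u t, t), subset_tsupport _ h, rfl⟩

theorem HasCompactSupport.comp_horizontal (hφ : HasCompactSupport φ) (t : ℝ) :
    HasCompactSupport fun x => φ (x, t) := by
  refine HasCompactSupport.intro (hφ.isCompact.image continuous_fst) fun x hx => ?_
  by_contra h
  exact hx ⟨(x, t), subset_tsupport _ h, rfl⟩

theorem HasCompactSupport.comp_shear (hφ : HasCompactSupport φ) (σ : ℝ) :
    HasCompactSupport fun p : ℝ × ℝ => φ (p.1 + σ * p.2, p.2) := by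
  refine HasCompactSupport.intro
    (hφ.isCompact.image (f := fun p : ℝ × ℝ => (p.1 - σ * p.2, p.2)) (by fun_prop))
    fun p hp => ?_
  by_contra h
  exact hp ⟨(p.1 + σ * p.2, p.2), subset_tsupport _ h, by simp⟩

theorem hasDerivAt_comp_line (hs : ContDiff ℝ (⊤ : ℕ∞) φ) (y σ t : ℝ) :
    HasDerivAt (fun t => φ (y + σ * t, t)) (fderiv ℝ φ (y + σ * t, t) (σ, 1)) t := by
  have h1 : HasDerivAt (fun t : ℝ => (y + σ * t, t)) (σ, 1) t := by
    simpa using ((((hasDerivAt_id t).const_mul σ).const_add y).prodMk (hasDerivAt_id t))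
  exact ((hs.differentiable (by simp)) _).hasFDerivAt.comp_hasDerivAt t h1

theorem hasDerivAt_comp_horizontal (hs : ContDiff ℝ (⊤ : ℕ∞) φ) (x t : ℝ) :
    HasDerivAt (fun x => φ (x, t)) (fderiv ℝ φ (x, t) (1, 0)) x :=
  ((hs.differentiable (by simp)) _).hasFDerivAt.comp_hasDerivAt x
    ((hasDerivAt_id x).prodMk (hasDerivAt_const x t))

theorem fderiv_apply_line (p : ℝ × ℝ) (σ : ℝ) :
    fderiv ℝ φ p (σ, 1) = σ * fderiv ℝ φ p (1, 0) + fderiv ℝ φ p (0, 1) := by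
  have : ((σ, 1) : ℝ × ℝ) = σ • (1, 0) + (0, 1) := by simp
  rw [this, map_add, map_smul, smul_eq_mul]

theorem continuous_fderiv_apply_const (hs : ContDiff ℝ (⊤ : ℕ∞) φ) (v : ℝ × ℝ) :
    Continuous fun p => fderiv ℝ φ p v :=
  (hs.continuous_fderiv (by simp)).clm_apply continuous_const

theorem integrable_fderiv_horizontal (hs : ContDiff ℝ (⊤ : ℕ∞) φ) (hc : HasCompactSupport φ)
    (v : ℝ × ℝ) (t : ℝ) : Integrable fun x => fderiv ℝ φ (x, t) v :=
  ((continuous_fderiv_apply_const hs v).comp (by fun_prop :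
    Continuous fun x : ℝ => (x, t))).integrable_of_hasCompactSupport
    ((hc.fderiv_apply ℝ v).comp_horizontal t)

theorem setIntegral_Iio_fderiv_horizontal (hs : ContDiff ℝ (⊤ : ℕ∞) φ)
    (hc : HasCompactSupport φ) (c t : ℝ) :
    ∫ x in Iio c, fderiv ℝ φ (x, t) (1, 0) = φ (c, t) := by
  rw [← integral_Iic_eq_integral_Iio]
  simp_rw [← fun x => (hasDerivAt_comp_horizontal hs x t).deriv]
  exact (hc.comp_horizontal t).integral_Iic_deriv_eq
    ((hs.comp (contDiff_id.prodMk contDiff_const)).of_le (by simp)) c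

theorem setIntegral_Ioi_fderiv_horizontal (hs : ContDiff ℝ (⊤ : ℕ∞) φ)
    (hc : HasCompactSupport φ) (c t : ℝ) :
    ∫ x in Ioi c, fderiv ℝ φ (x, t) (1, 0) = - φ (c, t) := by
  simp_rw [← fun x => (hasDerivAt_comp_horizontal hs x t).deriv]
  exact (hc.comp_horizontal t).integral_Ioi_deriv_eq
    ((hs.comp (contDiff_id.prodMk contDiff_const)).of_le (by simp)) c

theorem setIntegral_Ioo_eq_sub_Iio {f : ℝ → ℝ} (hf : Integrable f) {a b : ℝ} (hab : a < b) :
    ∫ x in Ioo a b, f x = (∫ x in Iio b, f x) - ∫ x in Iio a, f x := by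
  have h : Disjoint (Iic a) (Ioo a b) := Set.disjoint_left.2 fun x hx hx' => not_lt_of_ge hx hx'.1
  rw [← Iic_union_Ioo_eq_Iio hab, setIntegral_union h
    measurableSet_Ioo hf.integrableOn hf.integrableOn, integral_Iic_eq_integral_Iio]
  ring

theorem setIntegral_Ioi_eq_sub_Iio {f : ℝ → ℝ} (hf : Integrable f) (a : ℝ) :
    ∫ x in Ioi a, f x = (∫ x, f x) - ∫ x in Iio a, f x := by
  rw [← integral_add_compl measurableSet_Iic hf (s := Iic a), compl_Iic,
    integral_Iic_eq_integral_Iio]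
  ring

/-- Fubini for the derivative along the lines of slope `σ`. -/
theorem integral_shear_fderiv (hs : ContDiff ℝ (⊤ : ℕ∞) φ) (hc : HasCompactSupport φ)
    (h0 : ∀ x, φ (x, 0) = 0) (σ : ℝ) (S : Set ℝ) :
    IntegrableOn (fun t => ∫ y in S, fderiv ℝ φ (y + σ * t, t) (σ, 1)) (Ioi 0) ∧
      ∫ t in Ioi (0 : ℝ), ∫ y in S, fderiv ℝ φ (y + σ * t, t) (σ, 1) = 0 := by
  have hint : Integrable (fun p : ℝ × ℝ => fderiv ℝ φ (p.1 + σ * p.2, p.2) (σ, 1))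
      ((volume.restrict S).prod (volume.restrict (Ioi 0))) := by
    rw [Measure.prod_restrict, ← Measure.volume_eq_prod]
    exact (((continuous_fderiv_apply_const hs (σ, 1)).comp (by fun_prop :
      Continuous fun p : ℝ × ℝ => (p.1 + σ * p.2, p.2))).integrable_of_hasCompactSupport
      ((hc.fderiv_apply ℝ (σ, 1)).comp_shear σ)).restrict
  refine ⟨hint.integral_prod_right, ?_⟩
  rw [← integral_integral_swap (f := fun y t => fderiv ℝ φ (y + σ * t, t) (σ, 1)) hint]
  have h : ∀ y, ∫ t in Ioi (0 : ℝ), fderiv ℝ φ (y + σ * t, t) (σ, 1) = 0 := fun y => by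
    simp_rw [← fun t => (hasDerivAt_comp_line hs y σ t).deriv]
    refine ((hc.comp_graph_snd fun t => y + σ * t).integral_Ioi_deriv_eq ((hs.comp (by fun_prop :
      ContDiff ℝ (⊤ : ℕ∞) fun t : ℝ => (y + σ * t, t))).of_le (by simp)) 0).trans ?_
    simp [h0]
  simp [h]

theorem integral_time_fderiv (hs : ContDiff ℝ (⊤ : ℕ∞) φ) (hc : HasCompactSupport φ)
    (h0 : ∀ x, φ (x, 0) = 0) :
    IntegrableOn (fun t => ∫ x, fderiv ℝ φ (x, t) (0, 1)) (Ioi 0) ∧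
      ∫ t in Ioi (0 : ℝ), ∫ x, fderiv ℝ φ (x, t) (0, 1) = 0 := by
  simpa using integral_shear_fderiv hs hc h0 0 univ

theorem integrable_comp_line (hs : ContDiff ℝ (⊤ : ℕ∞) φ) (hc : HasCompactSupport φ) (σ : ℝ) :
    Integrable fun t => φ (σ * t, t) :=
  (hs.continuous.comp (by fun_prop :
    Continuous fun t : ℝ => (σ * t, t))).integrable_of_hasCompactSupport (hc.comp_graph_snd _)

theorem integral_Iio_time_fderiv (hs : ContDiff ℝ (⊤ : ℕ∞) φ) (hc : HasCompactSupport φ)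
    (h0 : ∀ x, φ (x, 0) = 0) (σ : ℝ) :
    IntegrableOn (fun t => ∫ x in Iio (σ * t), fderiv ℝ φ (x, t) (0, 1)) (Ioi 0) ∧
      ∫ t in Ioi (0 : ℝ), ∫ x in Iio (σ * t), fderiv ℝ φ (x, t) (0, 1) =
        -(σ * ∫ t in Ioi (0 : ℝ), φ (σ * t, t)) := by
  have key : ∀ t, ∫ x in Iio (σ * t), fderiv ℝ φ (x, t) (0, 1) =
      (∫ y in Iio 0, fderiv ℝ φ (y + σ * t, t) (σ, 1)) - σ * φ (σ * t, t) := fun t => by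
    have h := (measurePreserving_add_right volume (σ * t)).setIntegral_preimage_emb
      (measurableEmbedding_addRight (σ * t)) (fun x => fderiv ℝ φ (x, t) (σ, 1)) (Iio (σ * t))
    simp only [preimage_add_const_Iio, sub_self] at h
    rw [h, ← setIntegral_Iio_fderiv_horizontal hs hc]
    simp_rw [fderiv_apply_line _ σ]
    rw [integral_add ((integrable_fderiv_horizontal hs hc _ t).const_mul σ).restrict
      (integrable_fderiv_horizontal hs hc _ t).restrict, integral_const_mul]
    ring
  obtain ⟨h1, h2⟩ := integral_shear_fderiv hs hc h0 σ (Iio 0)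
  have h3 := ((integrable_comp_line hs hc σ).const_mul σ).integrableOn (s := Ioi 0)
  simp_rw [key]
  refine ⟨h1.sub h3, ?_⟩
  rw [integral_sub h1 h3, h2, integral_const_mul, zero_sub]

end Slices

theorem integrableOn_mul_of_continuousOn_Ici {m g : ℝ → ℝ} (hm : ContinuousOn m (Ici 0))
    (hg : Continuous g) (hc : HasCompactSupport g) :
    IntegrableOn (fun t => m t * g t) (Ioi 0) := by
  have hM : Continuous fun t => m (max 0 t) :=
    hm.comp_continuous (by fun_prop) fun t => mem_Ici.2 (le_max_left _ _)
  refine ((hM.mul hg).integrable_of_hasCompactSupport hc.mul_left).integrableOn.congr_fun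
    (fun t ht => ?_) measurableSet_Ioi
  simp [max_eq_right (le_of_lt (mem_Ioi.1 ht))]

theorem integral_Ioi_id_mul_deriv {a : ℝ → ℝ} (hs : ContDiff ℝ (⊤ : ℕ∞) a)
    (hc : HasCompactSupport a) :
    ∫ t in Ioi (0 : ℝ), t * deriv a t = -∫ t in Ioi (0 : ℝ), a t := by
  have hc' : HasCompactSupport fun t => t * a t := hc.mul_left
  have h := hc'.integral_Ioi_deriv_eq ((contDiff_id.mul hs).of_le (by simp)) 0
  have hd : ∀ t, deriv (fun t => t * a t) t = a t + t * deriv a t := fun t => by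
    rw [deriv_fun_mul differentiableAt_fun_id (hs.differentiable (by simp) t)]
    simp
  simp only [id, hd] at h
  rw [integral_add (hs.continuous.integrable_of_hasCompactSupport hc).restrict
    (integrableOn_mul_of_continuousOn_Ici continuous_id'.continuousOn (hs.continuous_deriv (by simp))
      hc.deriv)] at h
  simp only [zero_mul, neg_zero] at h
  linarith

/-- The fundamental lemma of the calculus of variations in the form of du Bois-Reymond. -/
theorem eq_zero_of_integral_mul_deriv_eq_zero {F : ℝ → ℝ} (hF : ContinuousOn F (Ici 0))
    (hF0 : F 0 = 0)
    (h : ∀ a : ℝ → ℝ, ContDiff ℝ (⊤ : ℕ∞) a → HasCompactSupport a → tsupport a ⊆ Ioi 0 →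
      ∫ t in Ioi (0 : ℝ), F t * deriv a t = 0) :
    ∀ t, 0 ≤ t → F t = 0 := by
  let b : ContDiffBump (1 : ℝ) := ⟨1 / 4, 1 / 2, by norm_num, by norm_num⟩
  set g₀ : ℝ → ℝ := b.normed volume with hg₀
  have hb1 : ∫ x, g₀ x = 1 := b.integral_normed
  have hbs : ContDiff ℝ (⊤ : ℕ∞) g₀ := b.contDiff_normed
  have hbc : HasCompactSupport g₀ := b.hasCompactSupport_normed
  have hbt : tsupport g₀ = Metric.closedBall 1 (1 / 2) := b.tsupport_normed_eq
  set c : ℝ := ∫ t in Ioi (0 : ℝ), F t * g₀ t with hcdef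
  have hae : ∀ᵐ t : ℝ, t ∈ Ioi (0 : ℝ) → F t - c = 0 := by
    refine isOpen_Ioi.ae_eq_zero_of_integral_contDiff_smul_eq_zero
      (((hF.mono Ioi_subset_Ici_self).sub continuousOn_const).locallyIntegrableOn
        measurableSet_Ioi) fun g hgs hgc hgt => ?_
    set k : ℝ → ℝ := fun t => g t - (∫ x, g x) * g₀ t with hk
    have hks : ContDiff ℝ (⊤ : ℕ∞) k := hgs.sub (contDiff_const.mul hbs)
    have hgi := hgs.continuous.integrable_of_hasCompactSupport hgc (μ := volume)
    have hbi := hbs.continuous.integrable_of_hasCompactSupport hbc (μ := volume)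
    have hk0 : ∫ t, k t = 0 := by
      rw [hk, integral_sub hgi (hbi.const_mul _), integral_const_mul, hb1]; ring
    set K := tsupport g ∪ tsupport g₀ with hK
    have hKc : IsCompact K := hgc.isCompact.union hbc.isCompact
    have hK1 : (1 : ℝ) ∈ K := Or.inr (by rw [hbt]; simp)
    have hKp : K ⊆ Ioi 0 := by
      refine union_subset hgt ?_
      rw [hbt, Real.closedBall_eq_Icc]
      intro x hx
      have := hx.1
      simp only [mem_Ioi]; linarith
    have hkK : ∀ t, t ∉ K → k t = 0 := fun t ht => by
      rw [hK, mem_union, not_or] at ht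
      simp [hk, image_eq_zero_of_notMem_tsupport ht.1, image_eq_zero_of_notMem_tsupport ht.2]
    obtain ⟨l, hlK, hl⟩ := hKc.exists_isLeast ⟨1, hK1⟩
    obtain ⟨u, huK, hu⟩ := hKc.exists_isGreatest ⟨1, hK1⟩
    have hl0 : 0 < l := hKp hlK
    set a : ℝ → ℝ := fun t => ∫ s in (0 : ℝ)..t, k s with ha
    have had : ∀ t, HasDerivAt a (k t) t := fun t =>
      (hks.continuous.integral_hasStrictDerivAt 0 t).hasDerivAt
    have had' : deriv a = k := funext fun t => (had t).deriv
    have has : ContDiff ℝ (⊤ : ℕ∞) a :=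
      contDiff_infty_iff_deriv.2 ⟨fun t => (had t).differentiableAt, by rwa [had']⟩
    have hsupp : Function.support a ⊆ Icc l u := by
      intro t ht
      by_contra hn
      apply ht
      rcases lt_or_ge t l with h1 | h1
      · rw [ha]
        refine (intervalIntegral.integral_congr (g := fun _ => 0) fun s hs => ?_).trans (by simp)
        refine hkK s fun hsK => ?_
        have h2 := hl hsK
        have h3 := hs.2
        rcases le_max_iff.1 h3 with h3 | h3 <;> linarith
      · have h2 : u < t := by
          by_contra h3
          exact hn ⟨h1, not_lt.1 h3⟩
        rw [ha]
        refine (intervalIntegral.integral_eq_integral_of_support_subset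
          fun s hs => ?_).trans hk0
        have hsK : s ∈ K := by
          by_contra h4
          exact hs (hkK s h4)
        exact ⟨hKp hsK, (hu hsK).trans h2.le⟩
    have h5 := h a has (.of_support_subset_isCompact isCompact_Icc hsupp)
      ((closure_minimal hsupp isClosed_Icc).trans fun t ht => hl0.trans_le ht.1)
    have hFg := integrableOn_mul_of_continuousOn_Ici hF hgs.continuous hgc
    have hFb := integrableOn_mul_of_continuousOn_Ici hF hbs.continuous hbc
    have hgz : ∀ t ∉ Ioi (0 : ℝ), g t = 0 := fun t ht =>
      image_eq_zero_of_notMem_tsupport fun h' => ht (hgt h')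
    have e1 : ∀ t, F t * k t = F t * g t - (∫ x, g x) * (F t * g₀ t) := fun t => by
      simp only [hk]; ring
    rw [had'] at h5
    simp_rw [e1] at h5
    rw [integral_sub hFg (hFb.const_mul _), integral_const_mul, ← hcdef] at h5
    rw [← setIntegral_eq_integral_of_forall_compl_eq_zero (s := Ioi 0)
      fun t ht => by simp [hgz t ht]]
    have e2 : ∀ t, g t • (F t - c) = F t * g t - g t * c := fun t => by
      simp only [smul_eq_mul]; ring
    simp_rw [e2]
    rw [integral_sub hFg (hgi.mul_const c).restrict, integral_mul_const,
      setIntegral_eq_integral_of_forall_compl_eq_zero hgz, h5]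
  have heq : EqOn F (fun _ => c) (Ioi 0) := by
    refine Measure.eqOn_open_of_ae_eq (μ := volume) ?_ isOpen_Ioi
      (hF.mono Ioi_subset_Ici_self) continuousOn_const
    filter_upwards [(ae_restrict_iff' measurableSet_Ioi).2 hae] with t ht
    linarith
  have heq' : EqOn F (fun _ => c) (Ici 0) :=
    heq.of_subset_closure hF continuousOn_const Ioi_subset_Ici_self (by rw [closure_Ioi])
  intro t ht
  have h1 := heq' (mem_Ici.2 ht)
  have h2 := heq' (mem_Ici.2 le_rfl)
  simp only at h1 h2
  rw [h1, ← h2, hF0]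

/-- A smooth function of time supported in `(0, ∞)` is the trace along one ray of a test function
vanishing along another ray. -/
theorem exists_test_function_with_traces {σ τ : ℝ} (hστ : σ ≠ τ) {a : ℝ → ℝ}
    (hs : ContDiff ℝ (⊤ : ℕ∞) a) (hc : HasCompactSupport a) (ht : tsupport a ⊆ Ioi 0) :
    ∃ φ : ℝ × ℝ → ℝ, ContDiff ℝ (⊤ : ℕ∞) φ ∧ HasCompactSupport φ ∧
      tsupport φ ⊆ (univ : Set ℝ) ×ˢ Ioi (0 : ℝ) ∧
      (∀ t, φ (σ * t, t) = a t) ∧ ∀ t, φ (τ * t, t) = 0 := by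
  let b : ContDiffBump (0 : ℝ) := ⟨1, 2, by norm_num, by norm_num⟩
  have ha0 : (0 : ℝ) ∉ tsupport a := fun h => lt_irrefl (0 : ℝ) (ht h)
  have hd : ContDiff ℝ (⊤ : ℕ∞) fun t => a t / t := by
    refine contDiff_iff_contDiffAt.2 fun t => ?_
    rcases eq_or_ne t 0 with rfl | h
    · refine (contDiffAt_const (c := (0 : ℝ))).congr_of_eventuallyEq ?_
      filter_upwards [notMem_tsupport_iff_eventuallyEq.1 ha0] with t h
      simp [h]
    · exact hs.contDiffAt.div contDiffAt_id h
  set φ : ℝ × ℝ → ℝ :=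
    fun p => a p.2 / p.2 * ((p.1 - τ * p.2) / (σ - τ)) * b (p.1 - σ * p.2) with hφ
  have hsupp : Function.support φ ⊆ Prod.snd ⁻¹' tsupport a := fun p hp => by
    by_contra h
    exact hp (by simp [hφ, image_eq_zero_of_notMem_tsupport h])
  refine ⟨φ, ?_, ?_, ?_, ?_, ?_⟩
  · refine ((hd.comp contDiff_snd).mul ?_).mul (b.contDiff.comp ?_)
    · fun_prop
    · fun_prop
  · refine HasCompactSupport.intro ((b.hasCompactSupport.isCompact.prod hc.isCompact).image
      (f := fun p : ℝ × ℝ => (p.1 + σ * p.2, p.2)) (by fun_prop)) fun p hp => ?_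
    by_contra h
    have hp2 : p.2 ∈ tsupport a := hsupp (Function.mem_support.2 h)
    refine hp ⟨(p.1 - σ * p.2, p.2), ⟨?_, hp2⟩, by simp⟩
    by_contra h'
    exact h (by simp only [hφ]; rw [image_eq_zero_of_notMem_tsupport h', mul_zero])
  · refine (closure_minimal hsupp ((isClosed_tsupport a).preimage continuous_snd)).trans
      fun p hp => ⟨trivial, ht hp⟩
  · intro t
    have hb : b 0 = 1 := b.one_of_mem_closedBall (by simp [b])
    rcases eq_or_ne t 0 with rfl | h
    · simp [hφ, image_eq_zero_of_notMem_tsupport ha0]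
    · have := sub_ne_zero.2 hστ
      simp only [hφ, sub_self, hb, ← sub_mul]
      field_simp
  · intro t
    simp [hφ]

theorem weak_form_eq (σL σR ηL ηs ηR qL qs qR sL sR : ℝ) (hσ : σL < σR)
    (mL mR : ℝ → ℝ) (hmLc : ContinuousOn mL (Ici 0)) (hmRc : ContinuousOn mR (Ici 0))
    {φ : ℝ × ℝ → ℝ} (hs : ContDiff ℝ (⊤ : ℕ∞) φ) (hc : HasCompactSupport φ)
    (h0 : ∀ x, φ (x, 0) = 0) :
    (-(∫ t in Set.Ioi (0:ℝ),
            ((∫ x in Set.Iio (σL * t), ηL * fderiv ℝ φ (x, t) (0, 1)) +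
              (∫ x in Set.Ioo (σL * t) (σR * t), ηs * fderiv ℝ φ (x, t) (0, 1)) +
              (∫ x in Set.Ioi (σR * t), ηR * fderiv ℝ φ (x, t) (0, 1)) +
              mL t * sL * fderiv ℝ φ (σL * t, t) (0, 1) +
              mR t * sR * fderiv ℝ φ (σR * t, t) (0, 1))) -
        (∫ t in Set.Ioi (0:ℝ),
            ((∫ x in Set.Iio (σL * t), qL * fderiv ℝ φ (x, t) (1, 0)) +
              (∫ x in Set.Ioo (σL * t) (σR * t), qs * fderiv ℝ φ (x, t) (1, 0)) +
              (∫ x in Set.Ioi (σR * t), qR * fderiv ℝ φ (x, t) (1, 0)) +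
              σL * (mL t * sL) * fderiv ℝ φ (σL * t, t) (1, 0) +
              σR * (mR t * sR) * fderiv ℝ φ (σR * t, t) (1, 0)))) =
      -((∫ t in Ioi (0 : ℝ), (σL * (ηL - ηs) * t - (qL - qs) * t + mL t * sL) *
            deriv (fun t => φ (σL * t, t)) t) +
        ∫ t in Ioi (0 : ℝ), (σR * (ηs - ηR) * t - (qs - qR) * t + mR t * sR) *
            deriv (fun t => φ (σR * t, t)) t) := by
  have hline : ∀ σ : ℝ, ContDiff ℝ (⊤ : ℕ∞) fun t : ℝ => (σ * t, t) := fun σ => by fun_prop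
  have hd : ∀ σ t, deriv (fun t => φ (σ * t, t)) t =
      σ * fderiv ℝ φ (σ * t, t) (1, 0) + fderiv ℝ φ (σ * t, t) (0, 1) := fun σ t => by
    rw [← fderiv_apply_line]
    simpa using (hasDerivAt_comp_line hs 0 σ t).deriv
  have hm : ∀ (m : ℝ → ℝ) (σ : ℝ) (v : ℝ × ℝ), ContinuousOn m (Ici 0) →
      IntegrableOn (fun t => m t * fderiv ℝ φ (σ * t, t) v) (Ioi 0) := fun m σ v h =>
    integrableOn_mul_of_continuousOn_Ici h
      ((continuous_fderiv_apply_const hs v).comp (hline σ).continuous)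
      ((hc.fderiv_apply ℝ v).comp_graph_snd _)
  obtain ⟨hAL, hAL'⟩ := integral_Iio_time_fderiv hs hc h0 σL
  obtain ⟨hAR, hAR'⟩ := integral_Iio_time_fderiv hs hc h0 σR
  obtain ⟨hT, hT'⟩ := integral_time_fderiv hs hc h0
  have haL := (integrable_comp_line hs hc σL).integrableOn (s := Ioi 0)
  have haR := (integrable_comp_line hs hc σR).integrableOn (s := Ioi 0)
  have hL01 := hm (fun t => mL t * sL) σL (0, 1) (hmLc.mul continuousOn_const)
  have hL10 := hm (fun t => mL t * sL) σL (1, 0) (hmLc.mul continuousOn_const)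
  have hR01 := hm (fun t => mR t * sR) σR (0, 1) (hmRc.mul continuousOn_const)
  have hR10 := hm (fun t => mR t * sR) σR (1, 0) (hmRc.mul continuousOn_const)
  have hx : ∀ σ t : ℝ, ∫ x in Ioi (σ * t), fderiv ℝ φ (x, t) (1, 0) = -φ (σ * t, t) :=
    fun σ t => setIntegral_Ioi_fderiv_horizontal hs hc _ t
  have hη : ∫ t in Set.Ioi (0:ℝ),
            ((∫ x in Set.Iio (σL * t), ηL * fderiv ℝ φ (x, t) (0, 1)) +
              (∫ x in Set.Ioo (σL * t) (σR * t), ηs * fderiv ℝ φ (x, t) (0, 1)) +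
              (∫ x in Set.Ioi (σR * t), ηR * fderiv ℝ φ (x, t) (0, 1)) +
              mL t * sL * fderiv ℝ φ (σL * t, t) (0, 1) +
              mR t * sR * fderiv ℝ φ (σR * t, t) (0, 1)) =
      -((ηL - ηs) * (σL * ∫ t in Ioi (0 : ℝ), φ (σL * t, t))) -
        (ηs - ηR) * (σR * ∫ t in Ioi (0 : ℝ), φ (σR * t, t)) +
        (∫ t in Ioi (0 : ℝ), mL t * sL * fderiv ℝ φ (σL * t, t) (0, 1)) +
        ∫ t in Ioi (0 : ℝ), mR t * sR * fderiv ℝ φ (σR * t, t) (0, 1) := by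
    have e : ∀ t ∈ Ioi (0 : ℝ),
        ((∫ x in Set.Iio (σL * t), ηL * fderiv ℝ φ (x, t) (0, 1)) +
              (∫ x in Set.Ioo (σL * t) (σR * t), ηs * fderiv ℝ φ (x, t) (0, 1)) +
              (∫ x in Set.Ioi (σR * t), ηR * fderiv ℝ φ (x, t) (0, 1)) +
              mL t * sL * fderiv ℝ φ (σL * t, t) (0, 1) +
              mR t * sR * fderiv ℝ φ (σR * t, t) (0, 1)) =
        (ηL - ηs) * (∫ x in Iio (σL * t), fderiv ℝ φ (x, t) (0, 1)) +
          (ηs - ηR) * (∫ x in Iio (σR * t), fderiv ℝ φ (x, t) (0, 1)) +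
          ηR * (∫ x, fderiv ℝ φ (x, t) (0, 1)) +
          mL t * sL * fderiv ℝ φ (σL * t, t) (0, 1) +
          mR t * sR * fderiv ℝ φ (σR * t, t) (0, 1) := fun t ht => by
      have hi := integrable_fderiv_horizontal hs hc (0, 1) t
      simp only [integral_const_mul]
      rw [setIntegral_Ioo_eq_sub_Iio hi (mul_lt_mul_of_pos_right hσ ht),
        setIntegral_Ioi_eq_sub_Iio hi]
      ring
    have i1 := hAL.const_mul (ηL - ηs)
    have i2 := hAR.const_mul (ηs - ηR)
    have i3 := hT.const_mul ηR
    rw [setIntegral_congr_fun measurableSet_Ioi e,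
      integral_add (((i1.fun_add i2).fun_add i3).fun_add hL01) hR01,
      integral_add ((i1.fun_add i2).fun_add i3) hL01, integral_add (i1.fun_add i2) i3, integral_add i1 i2]
    simp only [integral_const_mul]
    rw [hAL', hAR', hT']
    ring
  have hq : ∫ t in Set.Ioi (0:ℝ),
            ((∫ x in Set.Iio (σL * t), qL * fderiv ℝ φ (x, t) (1, 0)) +
              (∫ x in Set.Ioo (σL * t) (σR * t), qs * fderiv ℝ φ (x, t) (1, 0)) +
              (∫ x in Set.Ioi (σR * t), qR * fderiv ℝ φ (x, t) (1, 0)) +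
              σL * (mL t * sL) * fderiv ℝ φ (σL * t, t) (1, 0) +
              σR * (mR t * sR) * fderiv ℝ φ (σR * t, t) (1, 0)) =
      (qL - qs) * (∫ t in Ioi (0 : ℝ), φ (σL * t, t)) +
        (qs - qR) * (∫ t in Ioi (0 : ℝ), φ (σR * t, t)) +
        σL * (∫ t in Ioi (0 : ℝ), mL t * sL * fderiv ℝ φ (σL * t, t) (1, 0)) +
        σR * ∫ t in Ioi (0 : ℝ), mR t * sR * fderiv ℝ φ (σR * t, t) (1, 0) := by
    have e : ∀ t ∈ Ioi (0 : ℝ),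
        ((∫ x in Set.Iio (σL * t), qL * fderiv ℝ φ (x, t) (1, 0)) +
              (∫ x in Set.Ioo (σL * t) (σR * t), qs * fderiv ℝ φ (x, t) (1, 0)) +
              (∫ x in Set.Ioi (σR * t), qR * fderiv ℝ φ (x, t) (1, 0)) +
              σL * (mL t * sL) * fderiv ℝ φ (σL * t, t) (1, 0) +
              σR * (mR t * sR) * fderiv ℝ φ (σR * t, t) (1, 0)) =
        (qL - qs) * φ (σL * t, t) + (qs - qR) * φ (σR * t, t) +
          σL * (mL t * sL * fderiv ℝ φ (σL * t, t) (1, 0)) +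
          σR * (mR t * sR * fderiv ℝ φ (σR * t, t) (1, 0)) := fun t ht => by
      have hi := integrable_fderiv_horizontal hs hc (1, 0) t
      simp only [integral_const_mul]
      rw [setIntegral_Ioo_eq_sub_Iio hi (mul_lt_mul_of_pos_right hσ ht), hx,
        setIntegral_Iio_fderiv_horizontal hs hc, setIntegral_Iio_fderiv_horizontal hs hc]
      ring
    have i1 := haL.const_mul (qL - qs)
    have i2 := haR.const_mul (qs - qR)
    have i3 := hL10.const_mul σL
    have i4 := hR10.const_mul σR
    rw [setIntegral_congr_fun measurableSet_Ioi e, integral_add ((i1.fun_add i2).fun_add i3) i4,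
      integral_add (i1.fun_add i2) i3, integral_add i1 i2]
    simp only [integral_const_mul]
  have hF : ∀ (σ c d s : ℝ) (m : ℝ → ℝ), ContinuousOn m (Ici 0) →
      ∫ t in Ioi (0 : ℝ), (σ * c * t - d * t + m t * s) * deriv (fun t => φ (σ * t, t)) t =
        -((σ * c - d) * ∫ t in Ioi (0 : ℝ), φ (σ * t, t)) +
          σ * (∫ t in Ioi (0 : ℝ), m t * s * fderiv ℝ φ (σ * t, t) (1, 0)) +
          ∫ t in Ioi (0 : ℝ), m t * s * fderiv ℝ φ (σ * t, t) (0, 1) := by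
    intro σ c d s m hmc
    have hsl : ContDiff ℝ (⊤ : ℕ∞) fun t => φ (σ * t, t) := hs.comp (hline σ)
    have hcl : HasCompactSupport fun t => φ (σ * t, t) := hc.comp_graph_snd _
    have e : ∀ t, (σ * c * t - d * t + m t * s) * deriv (fun t => φ (σ * t, t)) t =
        (σ * c - d) * (t * deriv (fun t => φ (σ * t, t)) t) +
          σ * (m t * s * fderiv ℝ φ (σ * t, t) (1, 0)) +
          m t * s * fderiv ℝ φ (σ * t, t) (0, 1) := fun t => by
      rw [hd]; ring
    have i1 := (integrableOn_mul_of_continuousOn_Ici continuous_id'.continuousOn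
      (hsl.continuous_deriv (by simp)) hcl.deriv).const_mul (σ * c - d)
    have i2 := (hm (fun t => m t * s) σ (1, 0) (hmc.mul continuousOn_const)).const_mul σ
    have i3 := hm (fun t => m t * s) σ (0, 1) (hmc.mul continuousOn_const)
    simp_rw [e]
    rw [integral_add (i1.fun_add i2) i3, integral_add i1 i2]
    simp only [integral_const_mul]
    rw [integral_Ioi_id_mul_deriv hsl hcl]
    ring
  rw [hη, hq, hF _ _ _ _ _ hmLc, hF _ _ _ _ _ hmRc]
  ring


theorem stmt_18 (σL σR ηL ηs ηR qL qs qR sL sR : ℝ) (hσ : σL < σR)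
    (mL mR : ℝ → ℝ)
    (hmLc : ContinuousOn mL (Set.Ici 0)) (hmRc : ContinuousOn mR (Set.Ici 0))
    (hmL0 : mL 0 = 0) (hmR0 : mR 0 = 0) :
    (∀ φ : ℝ × ℝ → ℝ, ContDiff ℝ (⊤ : ℕ∞) φ → HasCompactSupport φ →
      tsupport φ ⊆ (Set.univ : Set ℝ) ×ˢ Set.Ioi (0:ℝ) →
      (-(∫ t in Set.Ioi (0:ℝ),
            ((∫ x in Set.Iio (σL * t), ηL * fderiv ℝ φ (x, t) (0, 1)) +
              (∫ x in Set.Ioo (σL * t) (σR * t), ηs * fderiv ℝ φ (x, t) (0, 1)) +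
              (∫ x in Set.Ioi (σR * t), ηR * fderiv ℝ φ (x, t) (0, 1)) +
              mL t * sL * fderiv ℝ φ (σL * t, t) (0, 1) +
              mR t * sR * fderiv ℝ φ (σR * t, t) (0, 1))) -
        (∫ t in Set.Ioi (0:ℝ),
            ((∫ x in Set.Iio (σL * t), qL * fderiv ℝ φ (x, t) (1, 0)) +
              (∫ x in Set.Ioo (σL * t) (σR * t), qs * fderiv ℝ φ (x, t) (1, 0)) +
              (∫ x in Set.Ioi (σR * t), qR * fderiv ℝ φ (x, t) (1, 0)) +
              σL * (mL t * sL) * fderiv ℝ φ (σL * t, t) (1, 0) +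
              σR * (mR t * sR) * fderiv ℝ φ (σR * t, t) (1, 0)))) = 0) ↔
    (∀ t : ℝ, 0 ≤ t →
      σL * (ηL - ηs) * t - (qL - qs) * t + mL t * sL = 0 ∧
      σR * (ηs - ηR) * t - (qs - qR) * t + mR t * sR = 0) := by
  have hFL : ContinuousOn (fun t => σL * (ηL - ηs) * t - (qL - qs) * t + mL t * sL) (Ici 0) :=
    (by fun_prop : Continuous fun t : ℝ => σL * (ηL - ηs) * t - (qL - qs) * t).continuousOn.add
      (hmLc.mul continuousOn_const)
  have hFR : ContinuousOn (fun t => σR * (ηs - ηR) * t - (qs - qR) * t + mR t * sR) (Ici 0) :=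
    (by fun_prop : Continuous fun t : ℝ => σR * (ηs - ηR) * t - (qs - qR) * t).continuousOn.add
      (hmRc.mul continuousOn_const)
  have h0 : ∀ φ : ℝ × ℝ → ℝ, tsupport φ ⊆ (univ : Set ℝ) ×ˢ Ioi (0 : ℝ) → ∀ x, φ (x, 0) = 0 :=
    fun φ h x => image_eq_zero_of_notMem_tsupport fun h' => lt_irrefl (0 : ℝ) (h h').2
  constructor
  · intro h
    have hL := eq_zero_of_integral_mul_deriv_eq_zero hFL (by simp [hmL0]) fun a hs hc ht => by
      obtain ⟨φ, hφs, hφc, hφt, h1, h2⟩ := exists_test_function_with_traces hσ.ne hs hc ht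
      have h3 := h φ hφs hφc hφt
      rw [weak_form_eq _ _ _ _ _ _ _ _ _ _ hσ _ _ hmLc hmRc hφs hφc (h0 φ hφt)] at h3
      simpa [h1, h2] using h3
    have hR := eq_zero_of_integral_mul_deriv_eq_zero hFR (by simp [hmR0]) fun a hs hc ht => by
      obtain ⟨φ, hφs, hφc, hφt, h1, h2⟩ := exists_test_function_with_traces hσ.ne' hs hc ht
      have h3 := h φ hφs hφc hφt
      rw [weak_form_eq _ _ _ _ _ _ _ _ _ _ hσ _ _ hmLc hmRc hφs hφc (h0 φ hφt)] at h3
      simpa [h1, h2] using h3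
    exact fun t ht => ⟨hL t ht, hR t ht⟩
  · intro h φ hφs hφc hφt
    rw [weak_form_eq _ _ _ _ _ _ _ _ _ _ hσ _ _ hmLc hmRc hφs hφc (h0 φ hφt),
      setIntegral_eq_zero_of_forall_eq_zero fun t ht => by
        rw [(h t (le_of_lt ht)).1, zero_mul],
      setIntegral_eq_zero_of_forall_eq_zero fun t ht => by
        rw [(h t (le_of_lt ht)).2, zero_mul]]
    simp
end
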